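/- Suppose P : ℂ → Prob(C([0,∞),ℂ)) is continuous and defines a Markovian time-changed Brownian motion. Fix z ∈ ℂ, let X have law P_z with X_u = 𝓑_{τ_u} as in the definition, and set A_t := inf{u ≥ 0 : τ_u = t} for t ≥ 0 (so that A_0 = 0, t ↦ A_t is continuous and strictly increasing, and B_t := X_{A_t} = 𝓑_t is a standard planar Brownian motion started from z). Then A is almost surely determined by B and is an additive functional of B: there exists a measurable map Φ from C([0,∞),ℂ) to the space of continuous nondecreasing functions [0,∞) → [0,∞), not depending on t, such that almost surely A = Φ(B), and for every s, t ≥ 0, almost surely A_{t+s} = A_t + Φ((B_{t+u})_{u≥0})_s. -/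

import Mathlib

open MeasureTheory ProbabilityTheory Filter Topology
open scoped ENNReal NNReal

noncomputable section

/-- The space `C([0,∞), ℂ)` of continuous paths, with the topology of uniform convergence
on compact time intervals. -/
abbrev PathSp : Type := C(ℝ≥0, ℂ)

instance : MeasurableSpace PathSp := borel PathSp

instance : BorelSpace PathSp := ⟨rfl⟩

/-- The centered planar Gaussian law on `ℂ` with covariance matrix `v·I₂`. -/
def planarGaussian (v : ℝ≥0) : Measure ℂ :=
  ((gaussianReal 0 v).prod (gaussianReal 0 v)).map fun p => Complex.equivRealProd.symm p

/-- `B` is a standard planar Brownian motion on `(Ω, μ)` started from `z`: it starts at `z`,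
has continuous sample paths, and for `s ≤ t` the increment `B_t − B_s` is independent of
`(B_u)_{u ≤ s}` and centered Gaussian with covariance matrix `(t−s)·I₂`. -/
structure IsPlanarBM {Ω : Type*} [MeasurableSpace Ω] (μ : Measure Ω)
    (B : ℝ≥0 → Ω → ℂ) (z : ℂ) : Prop where
  meas : ∀ t : ℝ≥0, Measurable (B t)
  start : ∀ᵐ ω ∂μ, B 0 ω = z
  cont : ∀ᵐ ω ∂μ, Continuous fun t => B t ω
  indep : ∀ s t : ℝ≥0, s ≤ t →
    Indep (MeasurableSpace.comap (fun ω => B t ω - B s ω) inferInstance)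
      (⨆ u ∈ Set.Iic s, MeasurableSpace.comap (B u) inferInstance) μ
  incr : ∀ s t : ℝ≥0, s ≤ t → μ.map (fun ω => B t ω - B s ω) = planarGaussian (t - s)

/-- Shift of a path by time `s`: `(pathShift s X) t = X (s + t)`. -/
def pathShift (s : ℝ≥0) (X : PathSp) : PathSp :=
  X.comp ⟨fun t => s + t, continuous_add_left s⟩

/-- The σ-algebra on path space generated by the coordinates `(X_u)_{0 ≤ u ≤ s}`. -/
def pastAlg (s : ℝ≥0) : MeasurableSpace PathSp :=
  ⨆ u ∈ Set.Iic s, MeasurableSpace.comap (fun X : PathSp => X u) inferInstance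

/-- Each `P_z` is supported on paths starting at `z`. -/
def StartsAt (P : ℂ → ProbabilityMeasure PathSp) : Prop :=
  ∀ z : ℂ, (P z : Measure PathSp) {X : PathSp | X 0 = z} = 1

/-- `P` is Markovian: for each `z` and `s ≥ 0`, the conditional law under `P_z` of the
shifted path `(X_{s+t})_{t ≥ 0}` given the past `(X_u)_{0 ≤ u ≤ s}` is almost surely
`P_{X_s}`, expressed by integration against events of the past σ-algebra. -/
def IsMarkovian (P : ℂ → ProbabilityMeasure PathSp) : Prop :=
  ∀ (z : ℂ) (s : ℝ≥0) (A : Set PathSp), MeasurableSet[pastAlg s] A →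
    ∀ g : PathSp → ℝ, Measurable g → (∃ C : ℝ, ∀ X, |g X| ≤ C) →
      ∫ X in A, g (pathShift s X) ∂(P z : Measure PathSp) =
        ∫ X in A, (∫ Y, g Y ∂(P (X s) : Measure PathSp)) ∂(P z : Measure PathSp)

/-- `(Ω, μ, B, τ, F)` realizes `ν` as a time-changed Brownian motion started from `z`:
`B` is a planar Brownian motion started at `z`, `τ` is a random continuous strictly
increasing time change with `τ_0 = 0` and `τ_u → ∞`, and the path `u ↦ B_{τ_u}`
(represented by the random continuous path `F`) has law `ν`. -/
def Realizes {Ω : Type} [MeasurableSpace Ω] (μ : Measure Ω) (B : ℝ≥0 → Ω → ℂ)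
    (τ : ℝ≥0 → Ω → ℝ≥0) (F : Ω → PathSp) (z : ℂ) (ν : Measure PathSp) : Prop :=
  IsProbabilityMeasure μ ∧ IsPlanarBM μ B z ∧
  (∀ᵐ ω ∂μ, τ 0 ω = 0 ∧ StrictMono (fun u => τ u ω) ∧
    Continuous (fun u => τ u ω) ∧ Tendsto (fun u => τ u ω) atTop atTop) ∧
  Measurable F ∧ (∀ᵐ ω ∂μ, ∀ u : ℝ≥0, F ω u = B (τ u ω) ω) ∧
  μ.map F = ν

/-- `P` is a time-changed Brownian motion: for each `z`, a process with law `P_z` can be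
realized as `X_u = B_{τ_u}` for a planar Brownian motion `B` started from `z` and a random
continuous strictly increasing time change `τ` with `τ_0 = 0` and `τ_u → ∞`. -/
def IsTimeChangedBM (P : ℂ → ProbabilityMeasure PathSp) : Prop :=
  ∀ z : ℂ, ∃ (Ω : Type) (mΩ : MeasurableSpace Ω) (μ : @Measure Ω mΩ)
    (B : ℝ≥0 → Ω → ℂ) (τ : ℝ≥0 → Ω → ℝ≥0) (F : Ω → PathSp),
      @Realizes Ω mΩ μ B τ F z (P z : Measure PathSp)

/-- `P` defines a Markovian time-changed Brownian motion. -/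
def DefinesMTCBM (P : ℂ → ProbabilityMeasure PathSp) : Prop :=
  StartsAt P ∧ IsMarkovian P ∧ IsTimeChangedBM P

/-- The Borel measure `μ` on `ℂ` is invariant for `P`. -/
def InvariantFor (P : ℂ → ProbabilityMeasure PathSp) (μ : Measure ℂ) : Prop :=
  ∀ (t : ℝ≥0) (A : Set ℂ), MeasurableSet A →
    ∫⁻ z, (P z : Measure PathSp) {X : PathSp | X t ∈ A} ∂μ = μ A

/-! ### Measurability on path space -/

/-- The path `X` stopped at time `u`. -/
def stopPath (u : ℝ≥0) (X : PathSp) : PathSp :=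
  X.comp ⟨fun t => min t u, by fun_prop⟩

@[simp] lemma stopPath_apply (u : ℝ≥0) (X : PathSp) (t : ℝ≥0) :
    stopPath u X t = X (min t u) := rfl

@[simp] lemma pathShift_apply (s : ℝ≥0) (X : PathSp) (t : ℝ≥0) :
    pathShift s X t = X (s + t) := rfl

lemma exists_nnrat_between {a b : ℝ≥0} (h : a < b) : ∃ q : ℚ≥0, a < q ∧ (q : ℝ≥0) < b := by
  obtain ⟨q, h1, h2⟩ := exists_rat_btwn (NNReal.coe_lt_coe.2 h)
  have hq : 0 ≤ q := by exact_mod_cast (a.2.trans h1.le : (0 : ℝ) ≤ q)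
  refine ⟨⟨q, hq⟩, ?_, ?_⟩
  · rw [← NNReal.coe_lt_coe]; exact h1
  · rw [← NNReal.coe_lt_coe]; exact h2

lemma denseRange_nnratCast_nnreal : DenseRange fun q : ℚ≥0 => (q : ℝ≥0) :=
  dense_of_exists_between fun _ _ h =>
    let ⟨q, h1, h2⟩ := exists_nnrat_between h
    ⟨q, ⟨q, rfl⟩, h1, h2⟩

lemma measurableEmbedding_evalRat :
    MeasurableEmbedding (fun (X : PathSp) (q : ℚ≥0) => X (q : ℝ≥0)) := by
  refine Measurable.measurableEmbedding ?_ ?_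
  · exact measurable_pi_lambda _ fun q => (continuous_eval_const _).measurable
  · intro X Y h
    have hd : DenseRange (fun q : ℚ≥0 => (q : ℝ≥0)) := by
      exact denseRange_nnratCast_nnreal
    refine ContinuousMap.coe_injective ?_
    exact hd.equalizer X.continuous Y.continuous h

lemma measurable_eval_path (t : ℝ≥0) : Measurable fun X : PathSp => X t :=
  (continuous_eval_const _).measurable

lemma measurable_to_path {α : Type*} [MeasurableSpace α] {f : α → PathSp}
    (h : ∀ t, Measurable fun a => f a t) : Measurable f := by
  rw [← measurableEmbedding_evalRat.measurable_comp_iff]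
  exact measurable_pi_lambda _ fun q => h _

lemma pastAlg_le (u : ℝ≥0) : pastAlg u ≤ (inferInstance : MeasurableSpace PathSp) :=
  iSup₂_le fun t _ => (measurable_eval_path t).comap_le

lemma measurable_pastAlg_eval {t u : ℝ≥0} (h : t ≤ u) :
    Measurable[pastAlg u] fun X : PathSp => X t := by
  rw [measurable_iff_comap_le]
  exact le_iSup₂_of_le (f := fun (t : ℝ≥0) (_ : t ∈ Set.Iic u) =>
    MeasurableSpace.comap (fun X : PathSp => X t) inferInstance) t h le_rfl

lemma measurable_stopPath (u : ℝ≥0) : Measurable[pastAlg u] (stopPath u) :=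
  @measurable_to_path _ (pastAlg u) _ fun _ => measurable_pastAlg_eval (min_le_right _ _)

lemma continuous_pathShift : Continuous fun p : ℝ≥0 × PathSp => pathShift p.1 p.2 := by
  refine ContinuousMap.continuous_of_continuous_uncurry _ ?_
  have : Continuous fun q : (ℝ≥0 × PathSp) × ℝ≥0 => q.1.2 (q.1.1 + q.2) := by fun_prop
  exact this

lemma continuous_eval_path : Continuous fun p : ℝ≥0 × PathSp => p.2 p.1 := by fun_prop

lemma measurable_eval_comp {α : Type*} [MeasurableSpace α] {f : α → ℝ≥0} {g : α → PathSp}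
    (hf : Measurable f) (hg : Measurable g) : Measurable fun a => g a (f a) :=
  continuous_eval_path.measurable.comp (hf.prodMk hg)

lemma measurable_pathShift_comp {α : Type*} [MeasurableSpace α] {f : α → ℝ≥0} {g : α → PathSp}
    (hf : Measurable f) (hg : Measurable g) : Measurable fun a => pathShift (f a) (g a) :=
  continuous_pathShift.measurable.comp (hf.prodMk hg)

lemma measurable_of_continuous_probabilityMeasure {P : ℂ → ProbabilityMeasure PathSp}
    (hP : Continuous P) : Measurable fun w => (P w : Measure PathSp) := by
  have key : ∀ F : Set PathSp, IsClosed F → Measurable fun w => (P w : Measure PathSp) F := by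
    intro F hF
    have hlim : ∀ w, Tendsto (fun n => ∫⁻ X, (hF.apprSeq n X : ℝ≥0∞) ∂(P w : Measure PathSp))
        atTop (𝓝 ((P w : Measure PathSp) F)) := fun w =>
      HasOuterApproxClosed.tendsto_lintegral_apprSeq hF (P w : Measure PathSp)
    refine measurable_of_tendsto_metrizable (fun n => ?_) (tendsto_pi_nhds.2 hlim)
    refine Continuous.measurable ?_
    refine continuous_iff_continuousAt.2 fun w => ?_
    exact (ProbabilityMeasure.tendsto_iff_forall_lintegral_tendsto.1 (hP.tendsto w)) (hF.apprSeq n)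
  refine Measurable.measure_of_isPiSystem_of_isProbabilityMeasure
    (S := {F : Set PathSp | IsClosed F}) ?_ isPiSystem_isClosed key
  rw [BorelSpace.measurable_eq (α := PathSp), borel_eq_generateFrom_isClosed]

/-! ### The grid skeleton of a continuous real path -/

/-- Times at which the path visits the grid `x 0 + ε ℤ`. -/
def gridTimes (ε : ℝ) (x : ℝ≥0 → ℝ) : Set ℝ≥0 := {s | ∃ k : ℤ, x s = x 0 + k * ε}

/-- The last visit of the grid before time `t`. -/
def lastGrid (ε : ℝ) (x : ℝ≥0 → ℝ) (t : ℝ≥0) : ℝ≥0 := sSup (Set.Iic t ∩ gridTimes ε x)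

/-- The value of the path at the last visit of the grid before time `t`. -/
def skeleton (ε : ℝ) (x : ℝ≥0 → ℝ) (t : ℝ≥0) : ℝ := x (lastGrid ε x t)

/-- The variation on `[0, u]` of the grid skeleton. -/
def gridVar (ε : ℝ) (x : ℝ≥0 → ℝ) (u : ℝ≥0) : ℝ≥0∞ := eVariationOn (skeleton ε x) (Set.Icc 0 u)

lemma isClosed_grid {ε : ℝ} (hε : 0 < ε) : IsClosed (Set.range fun k : ℤ => (k : ℝ) * ε) := by
  have h : IsClosedMap fun y : ℝ => y * ε := (Homeomorph.mulRight₀ ε hε.ne').isClosedMap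
  have := h _ Int.isClosedEmbedding_coe_real.isClosed_range
  rwa [← Set.range_comp] at this

lemma mem_gridTimes_iff {ε : ℝ} {x : ℝ≥0 → ℝ} {s : ℝ≥0} :
    s ∈ gridTimes ε x ↔ x s - x 0 ∈ Set.range fun k : ℤ => (k : ℝ) * ε := by
  simp only [gridTimes, Set.mem_ofPred_eq, Set.mem_range]
  exact exists_congr fun k => ⟨fun h => by rw [h]; ring, fun h => by rw [h]; ring⟩

lemma zero_mem_gridTimes (ε : ℝ) (x : ℝ≥0 → ℝ) : 0 ∈ gridTimes ε x := ⟨0, by simp⟩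

section Skeleton

variable {ε : ℝ} {x : ℝ≥0 → ℝ}

lemma isClosed_gridTimes (hε : 0 < ε) (hx : Continuous x) : IsClosed (gridTimes ε x) := by
  have : gridTimes ε x = (fun s => x s - x 0) ⁻¹' Set.range fun k : ℤ => (k : ℝ) * ε := by
    ext s; exact mem_gridTimes_iff
  rw [this]
  exact (isClosed_grid hε).preimage (by fun_prop)

lemma lastGrid_mem (hε : 0 < ε) (hx : Continuous x) (t : ℝ≥0) :
    lastGrid ε x t ∈ Set.Iic t ∩ gridTimes ε x :=
  (isClosed_Iic.inter (isClosed_gridTimes hε hx)).csSup_mem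
    ⟨0, Set.mem_Iic.2 zero_le, zero_mem_gridTimes ε x⟩ ⟨t, fun _ h => h.1⟩

lemma le_lastGrid {s t : ℝ≥0} (hst : s ≤ t) (hs : s ∈ gridTimes ε x) : s ≤ lastGrid ε x t :=
  le_csSup ⟨t, fun _ h => h.1⟩ ⟨hst, hs⟩

lemma lastGrid_mono : Monotone (lastGrid ε x) := fun _ t hst =>
  csSup_le_csSup ⟨t, fun _ h => h.1⟩ ⟨0, Set.mem_Iic.2 zero_le, zero_mem_gridTimes ε x⟩
    (Set.inter_subset_inter_left _ (Set.Iic_subset_Iic.2 hst))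

lemma lastGrid_eq_of_le (hε : 0 < ε) (hx : Continuous x) {s t : ℝ≥0} (hst : s ≤ t)
    (h : lastGrid ε x t ≤ s) : lastGrid ε x t = lastGrid ε x s :=
  le_antisymm (le_lastGrid h (lastGrid_mem hε hx t).2) (lastGrid_mono hst)

lemma skeleton_zero (ε : ℝ) (x : ℝ≥0 → ℝ) : skeleton ε x 0 = x 0 := by
  have : lastGrid ε x 0 = 0 := by
    refine le_antisymm (csSup_le ⟨0, Set.mem_Iic.2 le_rfl, zero_mem_gridTimes ε x⟩
      fun s h => h.1) zero_le
  rw [skeleton, this]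

lemma abs_sub_skeleton_le (hε : 0 < ε) (hx : Continuous x) (t : ℝ≥0) :
    |x t - skeleton ε x t| ≤ ε := by
  by_contra! hcon
  set ρ := lastGrid ε x t with hρ
  obtain ⟨hρt, k, hk⟩ := lastGrid_mem hε hx t
  rw [← hρ] at hρt hk
  have hsk : skeleton ε x t = x ρ := rfl
  rw [hsk] at hcon
  have hne : ∀ s, ρ < s → s ≤ t → s ∉ gridTimes ε x := fun s h1 h2 h3 =>
    absurd (le_lastGrid h2 h3) (not_le.2 h1)
  rcases lt_abs.1 hcon with h | h
  · have hmem : x ρ + ε ∈ Set.Icc (x ρ) (x t) := ⟨by linarith, by linarith⟩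
    obtain ⟨s, ⟨h1, h2⟩, h3⟩ := intermediate_value_Icc hρt hx.continuousOn hmem
    have h3' : x s = x ρ + ε := h3
    have hlt : ρ < s := lt_of_le_of_ne h1 (by rintro rfl; linarith)
    exact hne s hlt h2 ⟨k + 1, by rw [h3', hk]; push_cast; ring⟩
  · have hmem : x ρ - ε ∈ Set.Icc (x t) (x ρ) := ⟨by linarith, by linarith⟩
    obtain ⟨s, ⟨h1, h2⟩, h3⟩ := intermediate_value_Icc' hρt hx.continuousOn hmem
    have h3' : x s = x ρ - ε := h3
    have hlt : ρ < s := lt_of_le_of_ne h1 (by rintro rfl; linarith)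
    exact hne s hlt h2 ⟨k - 1, by rw [h3', hk]; push_cast; ring⟩

lemma eq_of_mem_gridTimes (hε : 0 < ε) {s t : ℝ≥0} (hs : s ∈ gridTimes ε x)
    (ht : t ∈ gridTimes ε x) (h : |x s - x t| < ε) : x s = x t := by
  obtain ⟨k, hk⟩ := hs
  obtain ⟨l, hl⟩ := ht
  have h1 : |((k - l : ℤ) : ℝ)| < 1 := by
    have : x s - x t = ((k - l : ℤ) : ℝ) * ε := by rw [hk, hl]; push_cast; ring
    rw [this, abs_mul, abs_of_pos hε] at h
    exact lt_of_mul_lt_mul_right (by linarith) hε.le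
  have h2 : k - l = 0 := by
    rw [← Int.cast_abs] at h1
    exact Int.abs_lt_one_iff.1 (by exact_mod_cast h1)
  rw [hk, hl, show k = l by lia]

lemma abs_sub_eq_zero_or_of_mem_gridTimes {s t : ℝ≥0} (hε : 0 < ε)
    (hs : s ∈ gridTimes ε x) (ht : t ∈ gridTimes ε x) (h : |x s - x t| < 2 * ε) :
    |x s - x t| = 0 ∨ |x s - x t| = ε := by
  obtain ⟨k, hk⟩ := hs
  obtain ⟨l, hl⟩ := ht
  have he : x s - x t = ((k - l : ℤ) : ℝ) * ε := by rw [hk, hl]; push_cast; ring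
  rw [he, abs_mul, abs_of_pos hε] at h ⊢
  have h1 : |((k - l : ℤ) : ℝ)| < 2 := lt_of_mul_lt_mul_right h hε.le
  rw [← Int.cast_abs] at h1 ⊢
  have h2 : |k - l| < 2 := by exact_mod_cast h1
  have h3 : 0 ≤ |k - l| := abs_nonneg _
  have h4 : |k - l| = 0 ∨ |k - l| = 1 := by lia
  rcases h4 with h4 | h4 <;> simp [h4]

/-- The oscillation of `x` on `[s, t]` is at most `η`. -/
def OscLE (x : ℝ≥0 → ℝ) (s t : ℝ≥0) (η : ℝ) : Prop :=
  ∀ r ∈ Set.Icc s t, ∀ r' ∈ Set.Icc s t, |x r - x r'| ≤ η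

lemma OscLE.mono {s t s' t' : ℝ≥0} {η : ℝ} (h : OscLE x s t η) (hs : s ≤ s') (ht : t' ≤ t) :
    OscLE x s' t' η := fun r hr r' hr' =>
  h r ⟨hs.trans hr.1, hr.2.trans ht⟩ r' ⟨hs.trans hr'.1, hr'.2.trans ht⟩

lemma skeleton_eq_or (hε : 0 < ε) (hx : Continuous x) {s r t : ℝ≥0} {η : ℝ} (hη : η < ε)
    (hsr : s ≤ r) (hrt : r ≤ t) (h : OscLE x s t η) :
    skeleton ε x r = skeleton ε x s ∨ skeleton ε x t = skeleton ε x r := by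
  by_cases hr : lastGrid ε x r ≤ s
  · left
    change x (lastGrid ε x r) = x (lastGrid ε x s)
    rw [lastGrid_eq_of_le hε hx hsr hr]
  · right
    have h1 := lastGrid_mono (ε := ε) (x := x) hrt
    have h2 := (lastGrid_mem hε hx t)
    have h3 := (lastGrid_mem hε hx r)
    push Not at hr
    change x (lastGrid ε x t) = x (lastGrid ε x r)
    refine eq_of_mem_gridTimes hε h2.2 h3.2 (lt_of_le_of_lt (h _ ⟨?_, h2.1⟩ _ ⟨hr.le, ?_⟩) hη)
    · exact hr.le.trans h1
    · exact h3.1.trans hrt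

lemma eVariationOn_skeleton_of_oscLE (hε : 0 < ε) (hx : Continuous x) {s t : ℝ≥0} {η : ℝ}
    (hη : η < ε) (hst : s ≤ t) (h : OscLE x s t η) :
    eVariationOn (skeleton ε x) (Set.Icc s t) =
      ENNReal.ofReal |skeleton ε x t - skeleton ε x s| := by
  have hdich : ∀ r ∈ Set.Icc s t, ∀ r' ∈ Set.Icc s t, r ≤ r' →
      skeleton ε x r = skeleton ε x s ∨ skeleton ε x r' = skeleton ε x r := fun r hr r' hr' hrr =>
    skeleton_eq_or hε hx hη hr.1 hrr (h.mono le_rfl hr'.2)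
  have hs : s ∈ Set.Icc s t := ⟨le_rfl, hst⟩
  have ht : t ∈ Set.Icc s t := ⟨hst, le_rfl⟩
  refine le_antisymm ?_ ?_
  · rcases le_total (skeleton ε x s) (skeleton ε x t) with hle | hle
    · have hm : MonotoneOn (skeleton ε x) (Set.Icc s t) := by
        intro r hr r' hr' hrr
        rcases hdich r hr r' hr' hrr with h1 | h1
        · rcases hdich r' hr' t ht hr'.2 with h2 | h2
          · rw [h1, h2]
          · rw [h1, ← h2]; exact hle
        · exact h1.ge
      have := hm.eVariationOn_eq hs ht
      rw [Set.inter_self] at this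
      exact this.le.trans (ENNReal.ofReal_le_ofReal (le_abs_self _))
    · have hm : AntitoneOn (skeleton ε x) (Set.Icc s t) := by
        intro r hr r' hr' hrr
        rcases hdich r hr r' hr' hrr with h1 | h1
        · rcases hdich r' hr' t ht hr'.2 with h2 | h2
          · rw [h1, h2]
          · rw [h1, ← h2]; exact hle
        · exact h1.le
      have := hm.neg.eVariationOn_eq hs ht
      rw [Set.inter_self] at this
      have h2 : eVariationOn (fun r => -skeleton ε x r) (Set.Icc s t) =
          eVariationOn (skeleton ε x) (Set.Icc s t) := by
        simp only [eVariationOn, edist_neg_neg]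
      rw [h2] at this
      refine this.le.trans (ENNReal.ofReal_le_ofReal ?_)
      rw [abs_sub_comm]
      exact le_trans (by ring_nf; rfl) (le_abs_self _)
  · have := eVariationOn.edist_le (skeleton ε x) ht hs
    rwa [edist_dist, Real.dist_eq] at this

lemma abs_skeleton_step (hε : 0 < ε) (hx : Continuous x) {s t : ℝ≥0} {η : ℝ}
    (hη : η < ε) (hst : s ≤ t) (h : OscLE x s t η) :
    (skeleton ε x t - skeleton ε x s = 0) ∨
      (|skeleton ε x t - skeleton ε x s| = ε ∧ |x t - skeleton ε x t| ≤ η) := by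
  by_cases ht : lastGrid ε x t ≤ s
  · left
    change x (lastGrid ε x t) - x (lastGrid ε x s) = 0
    rw [lastGrid_eq_of_le hε hx hst ht, sub_self]
  · push Not at ht
    have h1 := lastGrid_mem hε hx t
    have h2 := lastGrid_mem hε hx s
    have h3 : |x (lastGrid ε x t) - x s| ≤ η := h _ ⟨ht.le, h1.1⟩ _ ⟨le_rfl, hst⟩
    have h4 := abs_sub_skeleton_le hε hx s
    have h5 : |skeleton ε x t - skeleton ε x s| < 2 * ε := by
      calc |skeleton ε x t - skeleton ε x s|
          ≤ |skeleton ε x t - x s| + |x s - skeleton ε x s| := abs_sub_le _ _ _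
        _ < 2 * ε := by have : |skeleton ε x t - x s| ≤ η := h3
                        linarith
    rcases abs_sub_eq_zero_or_of_mem_gridTimes hε h1.2 h2.2 h5 with h6 | h6
    · left; exact abs_eq_zero.1 h6
    · exact Or.inr ⟨h6, h _ ⟨hst, le_rfl⟩ _ ⟨ht.le, h1.1⟩⟩

end Skeleton

/-! ### Dyadic sums -/

/-- The `j`-th point of the dyadic partition of `[0, t]` of level `n`. -/
def dyadicPt (t : ℝ≥0) (n j : ℕ) : ℝ≥0 := t * j / 2 ^ n

lemma dyadicPt_zero (t : ℝ≥0) (n : ℕ) : dyadicPt t n 0 = 0 := by simp [dyadicPt]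

lemma dyadicPt_last (t : ℝ≥0) (n : ℕ) : dyadicPt t n (2 ^ n) = t := by
  simp [dyadicPt]

lemma dyadicPt_mono (t : ℝ≥0) (n : ℕ) : Monotone (dyadicPt t n) := fun i j h => by
  unfold dyadicPt; gcongr

lemma dyadicPt_succ_sub (t : ℝ≥0) (n j : ℕ) :
    dyadicPt t n (j + 1) - dyadicPt t n j = t / 2 ^ n := by
  refine tsub_eq_of_eq_add ?_
  simp only [dyadicPt, Nat.cast_add, Nat.cast_one]; ring

lemma eventually_oscLE_dyadic {x : ℝ≥0 → ℝ} (hx : Continuous x) (t : ℝ≥0) {η : ℝ} (hη : 0 < η) :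
    ∀ᶠ n in atTop, ∀ j < 2 ^ n, OscLE x (dyadicPt t n j) (dyadicPt t n (j + 1)) η := by
  have hu : UniformContinuousOn x (Set.Icc 0 t) :=
    isCompact_Icc.uniformContinuousOn_of_continuous hx.continuousOn
  obtain ⟨δ, hδ, H⟩ := Metric.uniformContinuousOn_iff.1 hu η hη
  have hlim : Tendsto (fun n : ℕ => (t : ℝ) / 2 ^ n) atTop (𝓝 0) :=
    tendsto_const_nhds.div_atTop (tendsto_pow_atTop_atTop_of_one_lt one_lt_two)
  filter_upwards [hlim.eventually (gt_mem_nhds hδ)] with n hn j hj r hr r' hr'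
  have hj' : dyadicPt t n (j + 1) ≤ t := by
    rw [← dyadicPt_last t n]
    conv_lhs => rw [dyadicPt_last t n]
    exact dyadicPt_mono t n hj
  have hlen : (dyadicPt t n (j + 1) : ℝ) - dyadicPt t n j = t / 2 ^ n := by
    rw [← NNReal.coe_sub (dyadicPt_mono t n j.le_succ), dyadicPt_succ_sub]; simp
  have h1 : (dyadicPt t n j : ℝ) ≤ r := hr.1
  have h2 : (r : ℝ) ≤ dyadicPt t n (j + 1) := hr.2
  have h3 : (dyadicPt t n j : ℝ) ≤ r' := hr'.1
  have h4 : (r' : ℝ) ≤ dyadicPt t n (j + 1) := hr'.2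
  have := H r ⟨zero_le, hr.2.trans hj'⟩ r' ⟨zero_le, hr'.2.trans hj'⟩ (by
    rw [NNReal.dist_eq, abs_lt]; constructor <;> linarith)
  rw [Real.dist_eq] at this
  exact this.le

/-- Variation of the skeleton along the dyadic partition. -/
def dyadicVar (ε : ℝ) (x : ℝ≥0 → ℝ) (t : ℝ≥0) (n : ℕ) : ℝ :=
  ∑ j ∈ Finset.range (2 ^ n),
    |skeleton ε x (dyadicPt t n (j + 1)) - skeleton ε x (dyadicPt t n j)|

/-- The dyadic sum of squared increments, corrected by a discrete stochastic integral. -/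
def dyadicSum (ε : ℝ) (x : ℝ≥0 → ℝ) (t : ℝ≥0) (n : ℕ) : ℝ :=
  ∑ j ∈ Finset.range (2 ^ n), ((x (dyadicPt t n (j + 1)) - x (dyadicPt t n j)) ^ 2 +
    2 * (x (dyadicPt t n j) - skeleton ε x (dyadicPt t n j)) *
      (x (dyadicPt t n (j + 1)) - x (dyadicPt t n j)))

lemma eventually_gridVar_eq {ε : ℝ} {x : ℝ≥0 → ℝ} (hε : 0 < ε) (hx : Continuous x) (t : ℝ≥0) :
    ∀ᶠ n in atTop, gridVar ε x t = ENNReal.ofReal (dyadicVar ε x t n) := by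
  filter_upwards [eventually_oscLE_dyadic hx t (half_pos hε)] with n hn
  have h := eVariationOn.sum' (skeleton ε x) (dyadicPt_mono t n) (n := 2 ^ n)
  rw [dyadicPt_zero, dyadicPt_last] at h
  rw [gridVar, ← h, dyadicVar, ENNReal.ofReal_sum_of_nonneg fun _ _ => abs_nonneg _]
  refine Finset.sum_congr rfl fun j hj => ?_
  exact eVariationOn_skeleton_of_oscLE hε hx (half_lt_self hε) (dyadicPt_mono t n j.le_succ)
    (hn j (Finset.mem_range.1 hj))

lemma gridVar_ne_top {ε : ℝ} {x : ℝ≥0 → ℝ} (hε : 0 < ε) (hx : Continuous x) (t : ℝ≥0) :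
    gridVar ε x t ≠ ∞ := by
  obtain ⟨n, hn⟩ := (eventually_gridVar_eq hε hx t).exists
  rw [hn]; exact ENNReal.ofReal_ne_top

lemma abs_dyadicSum_sub_le {ε : ℝ} {x : ℝ≥0 → ℝ} (hε : 0 < ε) (hx : Continuous x) (t : ℝ≥0)
    {n : ℕ} {η : ℝ} (hη : η < ε)
    (h : ∀ j < 2 ^ n, OscLE x (dyadicPt t n j) (dyadicPt t n (j + 1)) η) :
    |dyadicSum ε x t n - ((x t - skeleton ε x t) ^ 2 + ε * dyadicVar ε x t n)| ≤
      2 * η * dyadicVar ε x t n := by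
  have htel : (x t - skeleton ε x t) ^ 2 = ∑ j ∈ Finset.range (2 ^ n),
      ((x (dyadicPt t n (j + 1)) - skeleton ε x (dyadicPt t n (j + 1))) ^ 2 -
        (x (dyadicPt t n j) - skeleton ε x (dyadicPt t n j)) ^ 2) := by
    rw [Finset.sum_range_sub
      (fun j => (x (dyadicPt t n j) - skeleton ε x (dyadicPt t n j)) ^ 2),
      dyadicPt_last, dyadicPt_zero, skeleton_zero]
    simp
  rw [htel, dyadicSum, dyadicVar, Finset.mul_sum, Finset.mul_sum, ← Finset.sum_add_distrib,
    ← Finset.sum_sub_distrib]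
  refine (Finset.abs_sum_le_sum_abs _ _).trans (Finset.sum_le_sum fun j hj => ?_)
  have hs := abs_skeleton_step hε hx hη (dyadicPt_mono t n j.le_succ) (h j (Finset.mem_range.1 hj))
  set a := x (dyadicPt t n j)
  set b := x (dyadicPt t n (j + 1))
  set r := skeleton ε x (dyadicPt t n j)
  set r' := skeleton ε x (dyadicPt t n (j + 1))
  have hid : (b - a) ^ 2 + 2 * (a - r) * (b - a) - ((b - r') ^ 2 - (a - r) ^ 2 + ε * |r' - r|) =
      |r' - r| ^ 2 - ε * |r' - r| + 2 * (r' - r) * (b - r') := by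
    rw [sq_abs]; ring
  rw [hid]
  rcases hs with h0 | ⟨h1, h2⟩
  · simp [h0]
  · rw [h1, show ε ^ 2 - ε * ε + 2 * (r' - r) * (b - r') = 2 * (r' - r) * (b - r') by ring,
      abs_mul, abs_mul, h1, abs_two]
    nlinarith

lemma tendsto_dyadicSum {ε : ℝ} {x : ℝ≥0 → ℝ} (hε : 0 < ε) (hx : Continuous x) (t : ℝ≥0) :
    Tendsto (dyadicSum ε x t) atTop
      (𝓝 ((x t - skeleton ε x t) ^ 2 + ε * (gridVar ε x t).toReal)) := by
  have hV : ∀ᶠ n in atTop, dyadicVar ε x t n = (gridVar ε x t).toReal := by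
    filter_upwards [eventually_gridVar_eq hε hx t] with n hn
    have h0 : 0 ≤ dyadicVar ε x t n := Finset.sum_nonneg fun _ _ => abs_nonneg _
    rw [hn, ENNReal.toReal_ofReal h0]
  rw [Metric.tendsto_atTop']
  intro δ hδ
  set V := (gridVar ε x t).toReal
  have hV0 : 0 ≤ V := ENNReal.toReal_nonneg
  have hη : 0 < min (ε / 2) (δ / (4 * (V + 1))) := by positivity
  obtain ⟨N, hN⟩ := eventually_atTop.1 (hV.and (eventually_oscLE_dyadic hx t hη))
  refine ⟨N, fun n hn => ?_⟩
  obtain ⟨h1, h2⟩ := hN n hn.le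
  have h3 := abs_dyadicSum_sub_le hε hx t
    (lt_of_le_of_lt (min_le_left _ _) (half_lt_self hε)) h2
  rw [h1] at h3
  rw [Real.dist_eq]
  refine lt_of_le_of_lt h3 ?_
  have h4 : min (ε / 2) (δ / (4 * (V + 1))) ≤ δ / (4 * (V + 1)) := min_le_right _ _
  calc 2 * min (ε / 2) (δ / (4 * (V + 1))) * V ≤ 2 * (δ / (4 * (V + 1))) * V := by gcongr
    _ = δ * (V / (2 * (V + 1))) := by field_simp; ring
    _ < δ * 1 := by
        gcongr
        rw [div_lt_one (by positivity)]; linarith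
    _ = δ := mul_one _

/-! ### The quadratic variation clock of a path -/

section SkeletonTransform

variable {ε : ℝ} {x y : ℝ≥0 → ℝ}

lemma skeleton_comp_orderIso (e : ℝ≥0 ≃o ℝ≥0) (t : ℝ≥0) :
    skeleton ε (x ∘ e) t = skeleton ε x (e t) := by
  have he0 : e 0 = 0 := e.map_bot
  have hne : (Set.Iic t ∩ gridTimes ε (x ∘ e)).Nonempty :=
    ⟨0, Set.mem_Iic.2 zero_le, zero_mem_gridTimes ε _⟩
  have himg : e '' (Set.Iic t ∩ gridTimes ε (x ∘ e)) = Set.Iic (e t) ∩ gridTimes ε x := by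
    ext s
    constructor
    · rintro ⟨r, ⟨h1, k, hk⟩, rfl⟩
      exact ⟨e.monotone h1, k, by simpa [he0] using hk⟩
    · rintro ⟨h1, k, hk⟩
      refine ⟨e.symm s, ⟨?_, k, ?_⟩, e.apply_symm_apply s⟩
      · exact e.symm_apply_le.2 h1
      · simpa [he0] using hk
  have : e (lastGrid ε (x ∘ e) t) = lastGrid ε x (e t) := by
    rw [lastGrid, e.map_csSup' hne ⟨t, fun _ h => h.1⟩, himg, lastGrid]
  change x (e (lastGrid ε (x ∘ e) t)) = _
  rw [this, skeleton]

lemma gridVar_comp_orderIso (e : ℝ≥0 ≃o ℝ≥0) (u : ℝ≥0) :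
    gridVar ε (x ∘ e) u = gridVar ε x (e u) := by
  have h1 : skeleton ε (x ∘ e) = skeleton ε x ∘ e := funext (skeleton_comp_orderIso e)
  have he0 : e 0 = 0 := e.map_bot
  rw [gridVar, h1, eVariationOn.comp_eq_of_monotoneOn _ _ (e.monotone.monotoneOn _),
    e.image_Icc, he0, gridVar]

lemma skeleton_congr {t u : ℝ≥0} (h : Set.EqOn x y (Set.Iic u)) (htu : t ≤ u)
    (hε : 0 < ε) (hx : Continuous x) : skeleton ε x t = skeleton ε y t := by
  have h0 : x 0 = y 0 := h (Set.mem_Iic.2 zero_le)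
  have : Set.Iic t ∩ gridTimes ε x = Set.Iic t ∩ gridTimes ε y := by
    ext s
    refine and_congr_right fun hs => ?_
    simp only [mem_gridTimes_iff, h0, h (show s ∈ Set.Iic u from le_trans hs htu)]
  have hl : lastGrid ε x t = lastGrid ε y t := by rw [lastGrid, this, lastGrid]
  rw [skeleton, skeleton, ← hl]
  exact h (le_trans (lastGrid_mem hε hx t).1 htu)

lemma gridVar_congr {t u : ℝ≥0} (h : Set.EqOn x y (Set.Iic u)) (htu : t ≤ u)
    (hε : 0 < ε) (hx : Continuous x) : gridVar ε x t = gridVar ε y t :=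
  eVariationOn.eq_of_eqOn fun _ hs => skeleton_congr h (hs.2.trans htu) hε hx

lemma gridVar_mono (ε : ℝ) (x : ℝ≥0 → ℝ) : Monotone (gridVar ε x) := fun _ _ h =>
  eVariationOn.mono _ (Set.Icc_subset_Icc_right h)

end SkeletonTransform

/-- The real part of a complex path. -/
def rePath (X : PathSp) (t : ℝ≥0) : ℝ := (X t).re

lemma continuous_rePath (X : PathSp) : Continuous (rePath X) := by unfold rePath; fun_prop

lemma measurable_lastGrid_rePath {ε : ℝ} (hε : 0 < ε) (t : ℝ≥0) :
    Measurable fun X : PathSp => lastGrid ε (rePath X) t := by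
  refine measurable_of_Ici fun r => IsClosed.measurableSet ?_
  have hset : (fun X : PathSp => lastGrid ε (rePath X) t) ⁻¹' Set.Ici r =
      Prod.snd '' {p : Set.Icc r t × PathSp | rePath p.2 p.1 - rePath p.2 0 ∈
        Set.range fun k : ℤ => (k : ℝ) * ε} := by
    ext X
    constructor
    · intro h
      have h1 := lastGrid_mem hε (continuous_rePath X) t
      exact ⟨(⟨_, h, h1.1⟩, X), mem_gridTimes_iff.1 h1.2, rfl⟩
    · rintro ⟨⟨⟨s, h1, h2⟩, Y⟩, h3, rfl⟩
      exact h1.trans (le_lastGrid h2 (mem_gridTimes_iff.2 h3))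
  rw [hset]
  refine isClosedMap_snd_of_compactSpace _ ((isClosed_grid hε).preimage ?_)
  unfold rePath
  fun_prop

lemma measurable_skeleton_rePath {ε : ℝ} (hε : 0 < ε) (t : ℝ≥0) :
    Measurable fun X : PathSp => skeleton ε (rePath X) t :=
  Complex.measurable_re.comp (measurable_eval_comp (measurable_lastGrid_rePath hε t) measurable_id)

lemma measurable_rePath (t : ℝ≥0) : Measurable fun X : PathSp => rePath X t :=
  Complex.measurable_re.comp (measurable_eval_path t)

lemma measurable_gridVar_rePath {ε : ℝ} (hε : 0 < ε) (t : ℝ≥0) :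
    Measurable fun X : PathSp => gridVar ε (rePath X) t := by
  refine measurable_of_tendsto_metrizable
    (f := fun n (X : PathSp) => ENNReal.ofReal (dyadicVar ε (rePath X) t n)) (fun n => ?_)
    (tendsto_pi_nhds.2 fun X => ?_)
  · refine ENNReal.measurable_ofReal.comp (Finset.measurable_sum _ fun j _ => ?_)
    exact ((measurable_skeleton_rePath hε _).sub (measurable_skeleton_rePath hε _)).norm
  · refine tendsto_const_nhds.congr' ?_
    filter_upwards [eventually_gridVar_eq hε (continuous_rePath X) t] with n hn using hn

/-- The intrinsic clock of a path: the limit of `ε` times the variation of the `ε`-grid skeleton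
of its real part, along `ε = 2⁻ᵐ`. -/
def clock (X : PathSp) (u : ℝ≥0) : ℝ≥0∞ :=
  limsup (fun m : ℕ => ENNReal.ofReal ((1 / 2) ^ m) * gridVar ((1 / 2) ^ m) (rePath X) u) atTop

lemma clock_mono (X : PathSp) : Monotone (clock X) := fun _ _ h =>
  limsup_le_limsup (Eventually.of_forall fun _ => by dsimp only; gcongr; exact gridVar_mono _ _ h)

lemma measurable_clock (u : ℝ≥0) : Measurable fun X => clock X u :=
  Measurable.limsup fun _ => measurable_const.mul (measurable_gridVar_rePath (by positivity) u)

lemma clock_comp_orderIso {X b : PathSp} (e : ℝ≥0 ≃o ℝ≥0) (h : ∀ u, X u = b (e u)) (u : ℝ≥0) :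
    clock X u = clock b (e u) := by
  have : rePath X = rePath b ∘ e := funext fun u => by simp [rePath, h u]
  simp only [clock, this, gridVar_comp_orderIso]

lemma clock_congr {X Y : PathSp} {v u : ℝ≥0} (h : Set.EqOn X Y (Set.Iic u)) (hv : v ≤ u) :
    clock X v = clock Y v := by
  have h' : Set.EqOn (rePath X) (rePath Y) (Set.Iic u) := fun s hs => by simp [rePath, h hs]
  unfold clock
  congr 1
  funext m
  rw [gridVar_congr h' hv (by positivity) (continuous_rePath X)]

lemma clock_stopPath (X : PathSp) {v u : ℝ≥0} (hv : v ≤ u) :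
    clock (stopPath u X) v = clock X v :=
  clock_congr (fun s hs => by simp [min_eq_left (Set.mem_Iic.1 hs)]) hv

/-! ### Brownian motion runs at unit speed for its intrinsic clock -/

section GaussianMoments

lemma exists_gaussian_fourth_moment_bound : ∃ C : ℝ, 0 ≤ C ∧ ∀ h : ℝ≥0,
    ∫ y, (y ^ 2 - h) ^ 2 ∂gaussianReal 0 h = C * h ^ 2 := by
  refine ⟨∫ y, (y ^ 2 - 1) ^ 2 ∂gaussianReal 0 1, integral_nonneg fun _ => sq_nonneg _, fun h => ?_⟩
  have hmap : gaussianReal 0 h = (gaussianReal 0 1).map fun y => √(h : ℝ) * y := by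
    rw [gaussianReal_map_const_mul]
    congr 1
    · simp
    · ext; simp
  rw [hmap, integral_map (by fun_prop) (by fun_prop), ← integral_mul_const]
  congr 1
  funext y
  rw [mul_pow, Real.sq_sqrt (NNReal.coe_nonneg h)]
  ring

lemma memLp_gaussianReal_sq (h : ℝ≥0) : MemLp (fun y : ℝ => y ^ 2 - h) 2 (gaussianReal 0 h) := by
  refine MemLp.sub ?_ (memLp_const _)
  rw [memLp_two_iff_integrable_sq (by fun_prop)]
  have := (memLp_id_gaussianReal (μ := 0) (v := h) 4).integrable_norm_pow (by norm_num)
  refine this.congr (Eventually.of_forall fun y => ?_)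
  simp only [id, Real.norm_eq_abs]
  rw [← pow_mul]
  exact (Even.pow_abs ⟨2, rfl⟩ y)

variable {Ω : Type*} [MeasurableSpace Ω] {μ : Measure Ω} [IsProbabilityMeasure μ]

lemma integral_sq_add_gaussian_step {C : ℝ}
    (hC : ∀ h : ℝ≥0, ∫ y, (y ^ 2 - h) ^ 2 ∂gaussianReal 0 h = C * h ^ 2)
    {M H ξ : Ω → ℝ} {h : ℝ≥0} {ε : ℝ} (hM : MemLp M 2 μ) (hH : Measurable H)
    (hHε : ∀ ω, |H ω| ≤ ε) (hξ : Measurable ξ) (hlaw : μ.map ξ = gaussianReal 0 h)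
    (hind : IndepFun ξ (fun ω => (M ω, H ω)) μ) :
    MemLp (fun ω => M ω + (ξ ω ^ 2 - h + 2 * H ω * ξ ω)) 2 μ ∧
      ∫ ω, (M ω + (ξ ω ^ 2 - h + 2 * H ω * ξ ω)) ^ 2 ∂μ ≤
        ∫ ω, M ω ^ 2 ∂μ + (2 * C * h ^ 2 + 8 * ε ^ 2 * h) := by
  have hξ2 : MemLp ξ 2 μ := by
    have := memLp_id_gaussianReal (μ := 0) (v := h) 2
    rw [← hlaw, memLp_map_measure_iff (by fun_prop) hξ.aemeasurable] at this
    exact this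
  have hQ2 : MemLp (fun ω => ξ ω ^ 2 - h) 2 μ := by
    have := memLp_gaussianReal_sq h
    rw [← hlaw, memLp_map_measure_iff (by fun_prop) hξ.aemeasurable] at this
    exact this
  have hHξ : MemLp (fun ω => 2 * H ω * ξ ω) 2 μ := by
    refine hξ2.of_le_mul (c := 2 * ε) (by fun_prop) (Eventually.of_forall fun ω => ?_)
    rw [norm_mul, norm_mul, Real.norm_ofNat]
    gcongr
    exact hHε ω
  have hY : MemLp (fun ω => ξ ω ^ 2 - h + 2 * H ω * ξ ω) 2 μ := hQ2.add hHξ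
  refine ⟨hM.add hY, ?_⟩
  have hξmean : ∫ ω, ξ ω ∂μ = 0 := by
    have := integral_id_gaussianReal (μ := 0) (v := h)
    rw [← hlaw, integral_map hξ.aemeasurable (by fun_prop)] at this
    exact this
  have hξvar : ∫ ω, ξ ω ^ 2 ∂μ = h := by
    have h1 := variance_fun_id_gaussianReal (μ := 0) (v := h)
    rw [variance_of_integral_eq_zero (by fun_prop)
      (integral_id_gaussianReal (μ := 0) (v := h)),
      ← hlaw, integral_map hξ.aemeasurable (by fun_prop)] at h1
    simpa using h1
  have hQmean : ∫ ω, (ξ ω ^ 2 - h) ∂μ = 0 := by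
    rw [integral_sub (hξ2.integrable_sq) (integrable_const _), hξvar]; simp
  have hQvar : ∫ ω, (ξ ω ^ 2 - h) ^ 2 ∂μ = C * h ^ 2 := by
    rw [← hC h, ← hlaw, integral_map hξ.aemeasurable (by fun_prop)]
  have hMm : AEStronglyMeasurable M μ := hM.1
  have c1 : ∫ ω, (ξ ω ^ 2 - h) * M ω ∂μ = 0 := by
    have hi : IndepFun (fun ω => ξ ω ^ 2 - h) M μ :=
      hind.comp (φ := fun y => y ^ 2 - (h : ℝ)) (ψ := Prod.fst) (by fun_prop) (by fun_prop)
    rw [hi.integral_fun_mul_eq_mul_integral (by fun_prop) hMm, hQmean, zero_mul]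
  have c2 : ∫ ω, ξ ω * (H ω * M ω) ∂μ = 0 := by
    have hi : IndepFun ξ (fun ω => H ω * M ω) μ :=
      hind.comp (φ := id) (ψ := fun p : ℝ × ℝ => p.2 * p.1) (by fun_prop) (by fun_prop)
    rw [hi.integral_fun_mul_eq_mul_integral (by fun_prop) (hH.aestronglyMeasurable.mul hMm),
      hξmean, zero_mul]
  have hMY : ∫ ω, M ω * (ξ ω ^ 2 - h + 2 * H ω * ξ ω) ∂μ = 0 := by
    have e : ∀ ω, M ω * (ξ ω ^ 2 - h + 2 * H ω * ξ ω) =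
        (ξ ω ^ 2 - h) * M ω + 2 * (ξ ω * (H ω * M ω)) := fun ω => by ring
    have i1 : Integrable (fun ω => (ξ ω ^ 2 - h) * M ω) μ := hQ2.integrable_mul hM
    have i2 : Integrable (fun ω => 2 * (ξ ω * (H ω * M ω))) μ :=
      (hHξ.integrable_mul hM).congr
        (Eventually.of_forall fun ω => by simp only [Pi.mul_apply]; ring)
    simp_rw [e]
    rw [integral_add i1 i2, integral_const_mul, c1, c2]; simp
  have hexp : ∫ ω, (M ω + (ξ ω ^ 2 - h + 2 * H ω * ξ ω)) ^ 2 ∂μ =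
      ∫ ω, M ω ^ 2 ∂μ + ∫ ω, (ξ ω ^ 2 - h + 2 * H ω * ξ ω) ^ 2 ∂μ := by
    have e : ∀ ω, (M ω + (ξ ω ^ 2 - h + 2 * H ω * ξ ω)) ^ 2 = M ω ^ 2 +
        (2 * (M ω * (ξ ω ^ 2 - h + 2 * H ω * ξ ω)) + (ξ ω ^ 2 - h + 2 * H ω * ξ ω) ^ 2) :=
      fun ω => by ring
    simp_rw [e]
    have i1 : Integrable (fun ω => 2 * (M ω * (ξ ω ^ 2 - h + 2 * H ω * ξ ω))) μ :=
      (hM.integrable_mul hY).const_mul 2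
    have i2 : Integrable (fun ω => 2 * (M ω * (ξ ω ^ 2 - h + 2 * H ω * ξ ω)) +
        (ξ ω ^ 2 - h + 2 * H ω * ξ ω) ^ 2) μ := i1.add hY.integrable_sq
    rw [integral_add hM.integrable_sq i2, integral_add i1 hY.integrable_sq, integral_const_mul, hMY]
    ring
  rw [hexp]
  gcongr
  calc ∫ ω, (ξ ω ^ 2 - h + 2 * H ω * ξ ω) ^ 2 ∂μ
      ≤ ∫ ω, (2 * (ξ ω ^ 2 - h) ^ 2 + 8 * ε ^ 2 * ξ ω ^ 2) ∂μ := by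
        refine integral_mono hY.integrable_sq
          ((hQ2.integrable_sq.const_mul 2).add (hξ2.integrable_sq.const_mul _)) fun ω => ?_
        have h1 : H ω ^ 2 ≤ ε ^ 2 := sq_le_sq' (abs_le.1 (hHε ω)).1 (abs_le.1 (hHε ω)).2
        have h2 : H ω ^ 2 * ξ ω ^ 2 ≤ ε ^ 2 * ξ ω ^ 2 := by gcongr
        dsimp only
        nlinarith [sq_nonneg (ξ ω ^ 2 - h - 2 * H ω * ξ ω)]
    _ = 2 * C * h ^ 2 + 8 * ε ^ 2 * h := by
        rw [integral_add (hQ2.integrable_sq.const_mul 2) (hξ2.integrable_sq.const_mul _),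
          integral_const_mul, integral_const_mul, hQvar, hξvar]
        ring

end GaussianMoments

/-- The real part of the canonical path has, under `ν`, Brownian increments
independent of the past. -/
def HasBrownianIncrements (ν : Measure PathSp) : Prop :=
  ∀ s t : ℝ≥0, s ≤ t → IndepFun (fun X => rePath X t - rePath X s) (stopPath s) ν ∧
    ν.map (fun X => rePath X t - rePath X s) = gaussianReal 0 (t - s)

/-- Partial sums of the compensated dyadic sum. -/
def compSum (ε : ℝ) (t : ℝ≥0) (n : ℕ) (X : PathSp) (k : ℕ) : ℝ :=
  ∑ j ∈ Finset.range k,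
    ((rePath X (dyadicPt t n (j + 1)) - rePath X (dyadicPt t n j)) ^ 2 - (t / 2 ^ n : ℝ≥0) +
    2 * (rePath X (dyadicPt t n j) - skeleton ε (rePath X) (dyadicPt t n j)) *
      (rePath X (dyadicPt t n (j + 1)) - rePath X (dyadicPt t n j)))

lemma compSum_last (ε : ℝ) (t : ℝ≥0) (n : ℕ) (X : PathSp) :
    compSum ε t n X (2 ^ n) = dyadicSum ε (rePath X) t n - t := by
  have : (t : ℝ) = ∑ j ∈ Finset.range (2 ^ n), ((t / 2 ^ n : ℝ≥0) : ℝ) := by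
    simp; field_simp
  rw [compSum, dyadicSum]
  conv_rhs => rw [this]
  rw [← Finset.sum_sub_distrib]
  exact Finset.sum_congr rfl fun _ _ => by ring

lemma measurable_compSum {ε : ℝ} (hε : 0 < ε) (t : ℝ≥0) (n k : ℕ) :
    Measurable fun X => compSum ε t n X k := by
  unfold compSum
  refine Finset.measurable_sum _ fun j _ => ?_
  have h1 := measurable_rePath (dyadicPt t n (j + 1))
  have h2 := measurable_rePath (dyadicPt t n j)
  have h3 := measurable_skeleton_rePath hε (dyadicPt t n j)
  fun_prop

lemma rePath_stopPath (X : PathSp) {s u : ℝ≥0} (h : s ≤ u) :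
    rePath (stopPath u X) s = rePath X s := by simp [rePath, min_eq_left h]

lemma skeleton_stopPath {ε : ℝ} (hε : 0 < ε) (X : PathSp) {s u : ℝ≥0} (h : s ≤ u) :
    skeleton ε (rePath (stopPath u X)) s = skeleton ε (rePath X) s :=
  skeleton_congr (fun _ hs => rePath_stopPath X hs) h hε (continuous_rePath _)

lemma compSum_stopPath {ε : ℝ} (hε : 0 < ε) (t : ℝ≥0) (n : ℕ) (X : PathSp) (k : ℕ) :
    compSum ε t n (stopPath (dyadicPt t n k) X) k = compSum ε t n X k := by
  refine Finset.sum_congr rfl fun j hj => ?_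
  have h1 : dyadicPt t n (j + 1) ≤ dyadicPt t n k := dyadicPt_mono t n (Finset.mem_range.1 hj)
  have h2 : dyadicPt t n j ≤ dyadicPt t n k := (dyadicPt_mono t n j.le_succ).trans h1
  rw [rePath_stopPath X h1, rePath_stopPath X h2, skeleton_stopPath hε X h2]

lemma integral_compSum_sq_le {ν : Measure PathSp} [IsProbabilityMeasure ν]
    (hν : HasBrownianIncrements ν) {C : ℝ}
    (hC : ∀ h : ℝ≥0, ∫ y, (y ^ 2 - h) ^ 2 ∂gaussianReal 0 h = C * h ^ 2)
    {ε : ℝ} (hε : 0 < ε) (t : ℝ≥0) (n k : ℕ) :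
    MemLp (fun X => compSum ε t n X k) 2 ν ∧ ∫ X, compSum ε t n X k ^ 2 ∂ν ≤
      k * (2 * C * (t / 2 ^ n : ℝ≥0) ^ 2 + 8 * ε ^ 2 * (t / 2 ^ n : ℝ≥0)) := by
  induction k with
  | zero => simp [compSum]
  | succ k ih =>
    obtain ⟨i1, i2⟩ := hν _ _ (dyadicPt_mono t n k.le_succ)
    rw [dyadicPt_succ_sub] at i2
    have hH : Measurable fun X : PathSp => rePath X (dyadicPt t n k) -
        skeleton ε (rePath X) (dyadicPt t n k) :=
      (measurable_rePath _).sub (measurable_skeleton_rePath hε _)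
    have hind : IndepFun (fun X => rePath X (dyadicPt t n (k + 1)) - rePath X (dyadicPt t n k))
        (fun X => (compSum ε t n X k, rePath X (dyadicPt t n k) -
          skeleton ε (rePath X) (dyadicPt t n k))) ν := by
      refine (IndepFun.comp (φ := fun y => y) i1 measurable_id
        ((measurable_compSum hε t n k).prodMk hH)).congr .rfl (.of_forall fun X => ?_)
      change (_, _) = (_, _)
      rw [compSum_stopPath hε, rePath_stopPath X le_rfl, skeleton_stopPath hε X le_rfl]
    have hstep := integral_sq_add_gaussian_step hC ih.1 hH
      (fun X => abs_sub_skeleton_le hε (continuous_rePath X) _)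
      ((measurable_rePath _).sub (measurable_rePath _)) i2 hind
    simp only [compSum, Finset.sum_range_succ] at hstep ⊢
    refine ⟨hstep.1, hstep.2.trans ?_⟩
    have := ih.2
    simp only [compSum] at this
    push_cast at this ⊢
    linarith

lemma lintegral_gridVar_sub_le {ν : Measure PathSp} [IsProbabilityMeasure ν]
    (hν : HasBrownianIncrements ν) {ε : ℝ} (hε : 0 < ε) (t : ℝ≥0) :
    ∫⁻ X, ENNReal.ofReal (((rePath X t - skeleton ε (rePath X) t) ^ 2 +
      ε * (gridVar ε (rePath X) t).toReal - t) ^ 2) ∂ν ≤ ENNReal.ofReal (8 * ε ^ 2 * t) := by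
  obtain ⟨C, -, hC⟩ := exists_gaussian_fourth_moment_bound
  have hlim : ∀ X : PathSp, Tendsto
      (fun n => ENNReal.ofReal (compSum ε t n X (2 ^ n) ^ 2)) atTop
      (𝓝 (ENNReal.ofReal (((rePath X t - skeleton ε (rePath X) t) ^ 2 +
      ε * (gridVar ε (rePath X) t).toReal - t) ^ 2))) := fun X => by
    simp only [compSum_last]
    exact ENNReal.tendsto_ofReal
      (((tendsto_dyadicSum hε (continuous_rePath X) t).sub_const _).pow 2)
  have hbd : ∀ n, ∫⁻ X, ENNReal.ofReal (compSum ε t n X (2 ^ n) ^ 2) ∂ν ≤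
      ENNReal.ofReal (2 * C * t ^ 2 / 2 ^ n + 8 * ε ^ 2 * t) := fun n => by
    obtain ⟨h1, h2⟩ := integral_compSum_sq_le hν hC hε t n (2 ^ n)
    rw [← ofReal_integral_eq_lintegral_ofReal h1.integrable_sq
      (Eventually.of_forall fun _ => sq_nonneg _)]
    refine ENNReal.ofReal_le_ofReal (h2.trans (le_of_eq ?_))
    push_cast
    field_simp
  calc _ = ∫⁻ X, liminf (fun n => ENNReal.ofReal (compSum ε t n X (2 ^ n) ^ 2)) atTop ∂ν :=
        lintegral_congr fun X => (hlim X).liminf_eq.symm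
    _ ≤ liminf (fun n => ∫⁻ X, ENNReal.ofReal (compSum ε t n X (2 ^ n) ^ 2) ∂ν) atTop :=
        lintegral_liminf_le fun n =>
          ENNReal.measurable_ofReal.comp ((measurable_compSum hε t n _).pow_const 2)
    _ ≤ liminf (fun n : ℕ => ENNReal.ofReal (2 * C * t ^ 2 / 2 ^ n + 8 * ε ^ 2 * t)) atTop :=
        liminf_le_liminf (Eventually.of_forall hbd)
    _ = ENNReal.ofReal (8 * ε ^ 2 * t) := by
        refine Tendsto.liminf_eq (ENNReal.tendsto_ofReal ?_)
        have : Tendsto (fun n : ℕ => 2 * C * (t : ℝ) ^ 2 / 2 ^ n) atTop (𝓝 0) :=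
          tendsto_const_nhds.div_atTop (tendsto_pow_atTop_atTop_of_one_lt one_lt_two)
        simpa using this.add_const (8 * ε ^ 2 * (t : ℝ))

lemma ae_clock_eq_of_fixed {ν : Measure PathSp} [IsProbabilityMeasure ν]
    (hν : HasBrownianIncrements ν) (t : ℝ≥0) : ∀ᵐ X ∂ν, clock X t = t := by
  let L : ℕ → PathSp → ℝ := fun m X => (rePath X t - skeleton ((1 / 2) ^ m) (rePath X) t) ^ 2 +
      (1 / 2) ^ m * (gridVar ((1 / 2) ^ m) (rePath X) t).toReal - t
  have hpos : ∀ m : ℕ, (0 : ℝ) < (1 / 2) ^ m := fun m => by positivity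
  have hLm : ∀ m, Measurable fun X => ENNReal.ofReal (L m X ^ 2) := fun m => by
    have h1 := measurable_rePath t
    have h2 := measurable_skeleton_rePath (hpos m) t
    have h3 := (measurable_gridVar_rePath (hpos m) t).ennreal_toReal
    fun_prop
  have hsum : ∑' m, ∫⁻ X, ENNReal.ofReal (L m X ^ 2) ∂ν ≠ ∞ := by
    have hs : Summable fun m : ℕ => 8 * (((1 : ℝ) / 2) ^ m) ^ 2 * t := by
      have : Summable fun m : ℕ => ((1 : ℝ) / 4) ^ m :=
        summable_geometric_of_lt_one (by norm_num) (by norm_num)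
      refine (this.mul_left (8 * (t : ℝ))).congr fun m => ?_
      rw [← pow_mul, mul_comm m 2, pow_mul]; norm_num; ring
    refine ne_top_of_le_ne_top ?_
      (ENNReal.tsum_le_tsum fun m => lintegral_gridVar_sub_le hν (hpos m) t)
    rw [← ENNReal.ofReal_tsum_of_nonneg (fun m => by positivity) hs]
    exact ENNReal.ofReal_ne_top
  rw [← lintegral_tsum fun m => (hLm m).aemeasurable] at hsum
  filter_upwards [ae_lt_top (Measurable.tsum hLm) hsum] with X hX
  have h0 := ENNReal.tendsto_atTop_zero_of_tsum_ne_top hX.ne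
  have hL0 : Tendsto (fun m => L m X) atTop (𝓝 0) := by
    have h1 := (ENNReal.tendsto_toReal ENNReal.zero_ne_top).comp h0
    have h2 : Tendsto (fun m => L m X ^ 2) atTop (𝓝 0) := by
      refine h1.congr fun m => ?_
      simp [ENNReal.toReal_ofReal (sq_nonneg (L m X))]
    have h3 := (Real.continuous_sqrt.tendsto _).comp h2
    rw [tendsto_zero_iff_abs_tendsto_zero]
    simpa [Function.comp_def, Real.sqrt_sq_eq_abs] using h3
  have hhalf : Tendsto (fun m : ℕ => ((1 : ℝ) / 2) ^ m) atTop (𝓝 0) :=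
    tendsto_pow_atTop_nhds_zero_of_lt_one (by norm_num) (by norm_num)
  have hD : Tendsto (fun m : ℕ => (rePath X t - skeleton ((1 / 2) ^ m) (rePath X) t) ^ 2) atTop
      (𝓝 0) := by
    have hd : Tendsto (fun m : ℕ => rePath X t - skeleton ((1 / 2) ^ m) (rePath X) t) atTop
        (𝓝 0) :=
      squeeze_zero_norm (fun m => abs_sub_skeleton_le (hpos m) (continuous_rePath X) t) hhalf
    simpa using hd.pow 2
  have hV : Tendsto (fun m : ℕ => (1 / 2 : ℝ) ^ m * (gridVar ((1 / 2) ^ m) (rePath X) t).toReal)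
      atTop (𝓝 t) := by
    have := (hL0.sub hD).add_const (t : ℝ)
    rw [sub_zero, zero_add] at this
    refine this.congr fun m => ?_
    simp only [L]; ring
  have hV' := ENNReal.tendsto_ofReal hV
  rw [ENNReal.ofReal_coe_nnreal] at hV'
  refine Tendsto.limsup_eq (hV'.congr fun m => ?_)
  rw [ENNReal.ofReal_mul (hpos m).le,
    ENNReal.ofReal_toReal (gridVar_ne_top (hpos m) (continuous_rePath X) t)]

lemma eq_coe_of_monotone_of_nnrat {f : ℝ≥0 → ℝ≥0∞} (hf : Monotone f)
    (h : ∀ q : ℚ≥0, f q = (q : ℝ≥0)) (t : ℝ≥0) : f t = t := by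
  refine le_antisymm ?_ ?_
  · refine le_of_forall_gt_imp_ge_of_dense fun c hc => ?_
    induction c with
    | top => exact le_top
    | coe c =>
      obtain ⟨q, h1, h2⟩ := exists_nnrat_between (ENNReal.coe_lt_coe.1 hc)
      exact (hf h1.le).trans ((h q).le.trans (ENNReal.coe_le_coe.2 h2.le))
  · refine le_of_forall_lt_imp_le_of_dense fun c hc => ?_
    lift c to ℝ≥0 using (hc.trans ENNReal.coe_lt_top).ne
    obtain ⟨q, h1, h2⟩ := exists_nnrat_between (ENNReal.coe_lt_coe.1 hc)
    exact (ENNReal.coe_le_coe.2 h1.le).trans ((h q).ge.trans (hf h2.le))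

lemma ae_clock_eq {ν : Measure PathSp} [IsProbabilityMeasure ν]
    (hν : HasBrownianIncrements ν) : ∀ᵐ X ∂ν, ∀ t : ℝ≥0, clock X t = t := by
  filter_upwards [ae_all_iff.2 fun q : ℚ≥0 => ae_clock_eq_of_fixed hν q] with X hX t
  exact eq_coe_of_monotone_of_nnrat (clock_mono X) hX t

/-! ### Laws with Brownian increments -/

lemma map_re_planarGaussian (v : ℝ≥0) :
    (planarGaussian v).map Complex.re = gaussianReal 0 v := by
  have hm : Measurable fun p : ℝ × ℝ => Complex.equivRealProd.symm p :=
    Complex.measurableEquivRealProd.symm.measurable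
  rw [planarGaussian, Measure.map_map Complex.measurable_re hm]
  have : Complex.re ∘ (fun p : ℝ × ℝ => Complex.equivRealProd.symm p) = Prod.fst := by
    funext p; simp
  rw [this, ← Measure.fst, Measure.fst_prod]

section

variable {Ω : Type*} [MeasurableSpace Ω] {μ : Measure Ω}

lemma indepFun_map_of_comp {α β γ : Type*} [MeasurableSpace α] [MeasurableSpace β]
    [MeasurableSpace γ] {G : Ω → α} (hG : Measurable G) {f : α → β} {g : α → γ}
    (hf : Measurable f) (hg : Measurable g) (h : IndepFun (f ∘ G) (g ∘ G) μ) :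
    IndepFun f g (μ.map G) := by
  rw [indepFun_iff_measure_inter_preimage_eq_mul] at h ⊢
  intro s t hs ht
  rw [Measure.map_apply hG ((hf hs).inter (hg ht)), Measure.map_apply hG (hf hs),
    Measure.map_apply hG (hg ht)]
  exact h s t hs ht

lemma IsPlanarBM.hasBrownianIncrements {B : ℝ≥0 → Ω → ℂ} {z : ℂ} (hB : IsPlanarBM μ B z)
    {G : Ω → PathSp} (hG : Measurable G) (hGB : ∀ᵐ ω ∂μ, ∀ s : ℝ≥0, G ω s = B s ω) :
    HasBrownianIncrements (μ.map G) := by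
  intro s t hst
  have hmd : Measurable fun X : PathSp => rePath X t - rePath X s :=
    (measurable_rePath t).sub (measurable_rePath s)
  have hae : (fun ω => (B t ω - B s ω).re) =ᵐ[μ]
      (fun X : PathSp => rePath X t - rePath X s) ∘ G := by
    filter_upwards [hGB] with ω hω
    simp [rePath, hω]
  constructor
  · refine indepFun_map_of_comp hG hmd ((measurable_stopPath s).mono (pastAlg_le s) le_rfl) ?_
    have h1 : IndepFun (fun ω => (B t ω - B s ω).re)
        (fun ω (q : ℚ≥0) => B (min (q : ℝ≥0) s) ω) μ := by
      rw [IndepFun_iff_Indep]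
      refine indep_of_indep_of_le_left (indep_of_indep_of_le_right (hB.indep s t hst) ?_) ?_
      · rw [← measurable_iff_comap_le]
        refine @measurable_pi_lambda _ _ _ (_) _ _ fun q => ?_
        rw [measurable_iff_comap_le]
        exact le_iSup₂_of_le (f := fun (u : ℝ≥0) (_ : u ∈ Set.Iic s) =>
          MeasurableSpace.comap (B u) inferInstance) (min (q : ℝ≥0) s)
          (Set.mem_Iic.2 (min_le_right _ _)) le_rfl
      · change MeasurableSpace.comap (Complex.re ∘ fun ω => B t ω - B s ω) _ ≤ _
        rw [← MeasurableSpace.comap_comp]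
        exact MeasurableSpace.comap_mono Complex.measurable_re.comap_le
    have h2 : IndepFun ((fun X : PathSp => rePath X t - rePath X s) ∘ G)
        ((fun (X : PathSp) (q : ℚ≥0) => X (q : ℝ≥0)) ∘ stopPath s ∘ G) μ := by
      refine h1.congr hae ?_
      filter_upwards [hGB] with ω hω
      funext q
      simp [hω]
    rw [IndepFun_iff_Indep] at h2 ⊢
    have h3 := MeasurableSpace.comap_comp (m := MeasurableSpace.pi) (g := stopPath s ∘ G)
      (f := fun (X : PathSp) (q : ℚ≥0) => X (q : ℝ≥0))
    rw [measurableEmbedding_evalRat.comap_eq] at h3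
    rwa [← h3] at h2
  · rw [Measure.map_map hmd hG, ← Measure.map_congr hae, ← map_re_planarGaussian,
      ← hB.incr s t hst, Measure.map_map Complex.measurable_re
        (show Measurable fun ω => B t ω - B s ω from (hB.meas t).sub (hB.meas s))]
    rfl

lemma IsPlanarBM.exists_path {B : ℝ≥0 → Ω → ℂ} {z : ℂ} (hB : IsPlanarBM μ B z) :
    ∃ G : Ω → PathSp, Measurable G ∧ ∀ᵐ ω ∂μ, ∀ s : ℝ≥0, G ω s = B s ω := by
  classical
  obtain ⟨N, hN, hNm, hN0⟩ := exists_measurable_superset_of_null (ae_iff.1 hB.cont)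
  have hc : ∀ ω, ω ∉ N → Continuous fun t => B t ω := fun ω h => by
    by_contra h'
    exact h (hN h')
  refine ⟨fun ω => if h : ω ∈ N then 0 else ⟨fun t => B t ω, hc ω h⟩, ?_, ?_⟩
  · refine measurable_to_path fun t => ?_
    have : (fun ω => (if h : ω ∈ N then (0 : PathSp) else ⟨fun t => B t ω, hc ω h⟩) t) =
        fun ω => if ω ∈ N then 0 else B t ω := by
      funext ω; split_ifs <;> rfl
    rw [this]
    exact Measurable.ite hNm measurable_const (hB.meas t)
  · filter_upwards [compl_mem_ae_iff.2 hN0] with ω hω s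
    have : ω ∉ N := hω
    simp [this]

end

lemma measurable_pathShift (s : ℝ≥0) : Measurable (pathShift s) :=
  measurable_pathShift_comp measurable_const measurable_id

lemma HasBrownianIncrements.map_pathShift {ν : Measure PathSp} (hν : HasBrownianIncrements ν)
    (r : ℝ≥0) : HasBrownianIncrements (ν.map (pathShift r)) := by
  intro s t hst
  obtain ⟨h1, h2⟩ := hν (r + s) (r + t) (add_le_add_right hst r)
  have hmd : Measurable fun X : PathSp => rePath X t - rePath X s :=
    (measurable_rePath t).sub (measurable_rePath s)
  have hms : ∀ u, Measurable (stopPath u) := fun u =>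
    (measurable_stopPath u).mono (pastAlg_le u) le_rfl
  constructor
  · refine indepFun_map_of_comp (measurable_pathShift r) hmd (hms s) ?_
    refine (IndepFun.comp (φ := fun y => y) h1 measurable_id
      ((hms s).comp (measurable_pathShift r))).congr .rfl (.of_forall fun X => ?_)
    ext v
    simp
  · rw [Measure.map_map hmd (measurable_pathShift r), ← add_tsub_add_eq_tsub_left r, ← h2]
    rfl

/-! ### The inverse clock and the associated time-changed path -/

/-- The right inverse of the intrinsic clock. -/
def invClock (X : PathSp) (r : ℝ≥0) : ℝ≥0 := sInf {v | (r : ℝ≥0∞) ≤ clock X v}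

/-- The path run at unit speed for its intrinsic clock. -/
def unitPath (X : PathSp) (r : ℝ≥0) : ℂ := X (invClock X r)

/-- The intrinsic clock of the path is a time change of `[0, ∞)`. -/
def IsClocked (X : PathSp) : Prop := ∃ e : ℝ≥0 ≃o ℝ≥0, ∀ v, clock X v = e v

lemma invClock_eq_symm {X : PathSp} {e : ℝ≥0 ≃o ℝ≥0} (h : ∀ v, clock X v = e v) (r : ℝ≥0) :
    invClock X r = e.symm r := by
  have : {v | (r : ℝ≥0∞) ≤ clock X v} = Set.Ici (e.symm r) := by
    ext v
    simp only [Set.mem_ofPred_eq, h, ENNReal.coe_le_coe, Set.mem_Ici]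
    exact e.symm_apply_le.symm
  rw [invClock, this, csInf_Ici]

lemma IsClocked.continuous_invClock {X : PathSp} (h : IsClocked X) : Continuous (invClock X) := by
  obtain ⟨e, he⟩ := h
  rw [funext (invClock_eq_symm he)]
  exact e.symm.continuous

lemma IsClocked.clock_invClock {X : PathSp} (h : IsClocked X) (s : ℝ≥0) :
    clock X (invClock X s) = s := by
  obtain ⟨e, he⟩ := h
  rw [invClock_eq_symm he, he, e.apply_symm_apply]

lemma measurable_invClock (r : ℝ≥0) : Measurable fun X => invClock X r := by
  refine measurable_of_Iio fun c => ?_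
  rcases eq_or_ne c 0 with rfl | hc
  · simp
  have hset : (fun X => invClock X r) ⁻¹' Set.Iio c =
      (⋃ (q : ℚ≥0) (_ : (q : ℝ≥0) < c), {X | (r : ℝ≥0∞) ≤ clock X q}) ∪
        ⋂ q : ℚ≥0, {X | clock X q < r} := by
    ext X
    simp only [Set.mem_preimage, Set.mem_Iio, Set.mem_union, Set.mem_iUnion, Set.mem_iInter,
      Set.mem_ofPred_eq, exists_prop]
    constructor
    · intro h
      rcases Set.eq_empty_or_nonempty {v | (r : ℝ≥0∞) ≤ clock X v} with h0 | h0
      · right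
        intro q
        by_contra! hq
        exact Set.notMem_empty (q : ℝ≥0) (h0 ▸ hq)
      · left
        obtain ⟨v, hv, hvc⟩ := (csInf_lt_iff (OrderBot.bddBelow _) h0).1 h
        obtain ⟨q, h1, h2⟩ := exists_nnrat_between hvc
        exact ⟨q, h2, le_trans hv (clock_mono X h1.le)⟩
    · rintro (⟨q, h1, h2⟩ | h)
      · exact lt_of_le_of_lt (csInf_le (OrderBot.bddBelow _) (Set.mem_ofPred_eq ▸ h2)) h1
      · have : {v | (r : ℝ≥0∞) ≤ clock X v} = ∅ := by
          refine Set.eq_empty_of_forall_notMem fun v hv => ?_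
          obtain ⟨q, h1, -⟩ := exists_nnrat_between (lt_add_one v)
          exact absurd (le_trans hv (clock_mono X h1.le)) (not_le.2 (h q))
        rw [invClock, this, NNReal.sInf_empty]
        exact pos_iff_ne_zero.2 hc
  rw [hset]
  refine (MeasurableSet.iUnion fun q => MeasurableSet.iUnion fun _ =>
    measurableSet_le measurable_const (measurable_clock _)).union
    (MeasurableSet.iInter fun q => measurableSet_lt (measurable_clock _) measurable_const)

lemma measurable_unitPath : Measurable unitPath :=
  measurable_pi_lambda _ fun r => measurable_eval_comp (measurable_invClock r) measurable_id

lemma exists_orderIso_of_continuous_strictMono {f : ℝ≥0 → ℝ≥0} (h0 : f 0 = 0) (hf : StrictMono f)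
    (hc : Continuous f) (hu : ∀ y, ∃ v, y ≤ f v) : ∃ e : ℝ≥0 ≃o ℝ≥0, ∀ v, f v = e v := by
  have hs : Function.Surjective f := fun y => by
    obtain ⟨v, hv⟩ := hu y
    obtain ⟨w, -, hw⟩ := intermediate_value_Icc (zero_le : 0 ≤ v) hc.continuousOn
      (show y ∈ Set.Icc (f 0) (f v) from ⟨h0.trans_le zero_le, hv⟩)
    exact ⟨w, hw⟩
  exact ⟨hf.orderIsoOfSurjective f hs, fun _ => rfl⟩

lemma isClocked_iff (X : PathSp) : IsClocked X ↔ (clock X 0 = 0 ∧ (∀ q : ℚ≥0, clock X q < ∞) ∧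
    (∀ p q : ℚ≥0, p < q → clock X p < clock X q) ∧
    ∀ p q : ℚ≥0, p < q → ∃ r : ℚ≥0, ((p : ℝ≥0) : ℝ≥0∞) < clock X r ∧ clock X r < (q : ℝ≥0)) := by
  constructor
  · rintro ⟨e, he⟩
    simp only [he, ENNReal.coe_lt_top, ENNReal.coe_lt_coe, e.lt_iff_lt]
    refine ⟨by simpa using e.map_bot, fun _ => trivial, fun p q h => by exact_mod_cast h,
      fun p q h => ?_⟩
    have h' : e.symm p < e.symm q := e.symm.strictMono (by exact_mod_cast h)
    obtain ⟨r, h1, h2⟩ := exists_nnrat_between h'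
    exact ⟨r, e.symm_apply_lt.1 h1, e.lt_symm_apply.1 h2⟩
  · rintro ⟨h0, hfin, hlt, hd⟩
    have hfin' : ∀ v, clock X v ≠ ∞ := fun v => by
      obtain ⟨q, h1, -⟩ := exists_nnrat_between (lt_add_one v)
      exact ((clock_mono X h1.le).trans_lt (hfin q)).ne
    let f : ℝ≥0 → ℝ≥0 := fun v => (clock X v).toNNReal
    have hf : ∀ v, clock X v = f v := fun v => (ENNReal.coe_toNNReal (hfin' v)).symm
    have hm : StrictMono f := fun a b hab => by
      obtain ⟨p, h1, h2⟩ := exists_nnrat_between hab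
      obtain ⟨q, h3, h4⟩ := exists_nnrat_between h2
      rw [← ENNReal.coe_lt_coe, ← hf, ← hf]
      exact (clock_mono X h1.le).trans_lt ((hlt p q (by exact_mod_cast h3)).trans_le
        (clock_mono X h4.le))
    have hdense : DenseRange f := dense_of_exists_between fun a b hab => by
      obtain ⟨p, h1, h2⟩ := exists_nnrat_between hab
      obtain ⟨q, h3, h4⟩ := exists_nnrat_between h2
      obtain ⟨r, h5, h6⟩ := hd p q (by exact_mod_cast h3)
      rw [hf, ENNReal.coe_lt_coe] at h5 h6
      exact ⟨f r, ⟨r, rfl⟩, h1.trans h5, h6.trans h4⟩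
    obtain ⟨e, he⟩ := exists_orderIso_of_continuous_strictMono (f := f) (by simp [f, h0]) hm
      (hm.monotone.continuous_of_denseRange hdense) fun y => by
        obtain ⟨_, ⟨v, rfl⟩, h, -⟩ := hdense.exists_between (lt_add_one y)
        exact ⟨v, h.le⟩
    exact ⟨e, fun v => by rw [hf, he]⟩

lemma measurableSet_isClocked : MeasurableSet {X | IsClocked X} := by
  have hset : {X | IsClocked X} = {X | clock X 0 = 0} ∩ ((⋂ q : ℚ≥0, {X | clock X q < ∞}) ∩
      ((⋂ (p : ℚ≥0) (q : ℚ≥0) (_ : p < q), {X | clock X p < clock X q}) ∩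
        ⋂ (p : ℚ≥0) (q : ℚ≥0) (_ : p < q), ⋃ r : ℚ≥0,
          {X | ((p : ℝ≥0) : ℝ≥0∞) < clock X r} ∩ {X | clock X r < (q : ℝ≥0)})) := by
    ext X
    rw [Set.mem_ofPred_eq, isClocked_iff]
    simp
  rw [hset]
  have h := fun u => measurable_clock u
  refine (measurableSet_eq_fun (h _) measurable_const).inter (.inter ?_ (.inter ?_ ?_))
  · exact .iInter fun q => measurableSet_lt (h _) measurable_const
  · exact .iInter fun p => .iInter fun q => .iInter fun _ => measurableSet_lt (h _) (h _)
  · exact .iInter fun p => .iInter fun q => .iInter fun _ => .iUnion fun r =>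
      (measurableSet_lt measurable_const (h _)).inter (measurableSet_lt (h _) measurable_const)

section Nonanticipation

variable {X : PathSp} {s u : ℝ≥0}

lemma invClock_le (h : (s : ℝ≥0∞) ≤ clock X u) : invClock X s ≤ u :=
  csInf_le (OrderBot.bddBelow _) h

lemma invClock_stopPath {r : ℝ≥0} (hr : r ≤ s) (h : (s : ℝ≥0∞) ≤ clock X u) :
    invClock (stopPath u X) r = invClock X r := by
  have hr' : (r : ℝ≥0∞) ≤ clock X u := (ENNReal.coe_le_coe.2 hr).trans h
  have hr2 : (r : ℝ≥0∞) ≤ clock (stopPath u X) u := by rwa [clock_stopPath X le_rfl]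
  refine le_antisymm (le_csInf ⟨u, hr'⟩ fun v hv => ?_) (le_csInf ⟨u, hr2⟩ fun v hv => ?_)
  · rcases le_total v u with hvu | hvu
    · exact invClock_le (by rw [clock_stopPath X hvu]; exact hv)
    · exact (invClock_le hr2).trans hvu
  · rcases le_total v u with hvu | hvu
    · exact invClock_le (by rw [← clock_stopPath X hvu]; exact hv)
    · exact (invClock_le hr').trans hvu

lemma unitPath_stopPath {r : ℝ≥0} (hr : r ≤ s) (h : (s : ℝ≥0∞) ≤ clock X u) :
    unitPath (stopPath u X) r = unitPath X r := by
  rw [unitPath, invClock_stopPath hr h, stopPath_apply, unitPath, min_eq_left]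
  exact invClock_le ((ENNReal.coe_le_coe.2 hr).trans h)

end Nonanticipation

/-- The path after the time at which its intrinsic clock reaches `s`. -/
def clockShift (s : ℝ≥0) (X : PathSp) : PathSp := pathShift (invClock X s) X

lemma measurable_clockShift (s : ℝ≥0) : Measurable (clockShift s) :=
  measurable_pathShift_comp (measurable_invClock s) measurable_id

/-- The path and its shift at clock time `s` have compatible clocks. -/
structure IsShiftClocked (s : ℝ≥0) (X : PathSp) : Prop where
  clocked : IsClocked X
  shift : IsClocked (clockShift s X)
  invClock_add : ∀ r, invClock X (s + r) = invClock X s + invClock (clockShift s X) r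

lemma IsShiftClocked.unitPath_add {s : ℝ≥0} {X : PathSp} (h : IsShiftClocked s X) (r : ℝ≥0) :
    unitPath X (s + r) = unitPath (clockShift s X) r := by
  rw [unitPath, h.invClock_add]; rfl

lemma measurableSet_isShiftClocked (s : ℝ≥0) : MeasurableSet {X | IsShiftClocked s X} := by
  have hset : {X | IsShiftClocked s X} = ({X | IsClocked X} ∩ clockShift s ⁻¹' {X | IsClocked X}) ∩
      ⋂ q : ℚ≥0, {X | invClock X (s + q) = invClock X s + invClock (clockShift s X) q} := by
    ext X
    constructor
    · exact fun h => ⟨⟨h.1, h.2⟩, Set.mem_iInter.2 fun q => h.3 q⟩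
    · rintro ⟨⟨h1, h2⟩, h3⟩
      refine ⟨h1, h2, fun r => ?_⟩
      have c1 := h1.continuous_invClock
      have c2 : Continuous (invClock (clockShift s X)) := IsClocked.continuous_invClock h2
      have c3 : Continuous fun r => invClock X (s + r) := by fun_prop
      have c4 : Continuous fun r => invClock X s + invClock (clockShift s X) r := by fun_prop
      exact congrFun (denseRange_nnratCast_nnreal.equalizer c3 c4
        (funext fun q => Set.mem_iInter.1 h3 q)) r
  rw [hset]
  refine (measurableSet_isClocked.inter
    (measurable_clockShift s measurableSet_isClocked)).inter (.iInter fun q => ?_)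
  exact measurableSet_eq_fun (measurable_invClock _)
    ((measurable_invClock s).add ((measurable_invClock _).comp (measurable_clockShift s)))

section TimeChange

variable {X b : PathSp} {e : ℝ≥0 ≃o ℝ≥0}

lemma clock_eq_of_timeChange (hX : ∀ u, X u = b (e u)) (hb : ∀ t, clock b t = t) (u : ℝ≥0) :
    clock X u = e u := by
  rw [clock_comp_orderIso e hX, hb]

lemma unitPath_eq_of_timeChange (hX : ∀ u, X u = b (e u)) (hb : ∀ t, clock b t = t) (r : ℝ≥0) :
    unitPath X r = b r := by
  rw [unitPath, invClock_eq_symm (clock_eq_of_timeChange hX hb), hX, e.apply_symm_apply]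

lemma isShiftClocked_of_timeChange (hX : ∀ u, X u = b (e u)) (hb : ∀ t, clock b t = t) {s : ℝ≥0}
    (hbs : ∀ t, clock (pathShift s b) t = t) : IsShiftClocked s X := by
  have hclk := clock_eq_of_timeChange hX hb
  have hinv := invClock_eq_symm hclk
  have hle : ∀ v, s ≤ e (e.symm s + v) := fun v => by
    rw [← e.symm_apply_le]; exact le_self_add
  have hle' : ∀ r, e.symm s ≤ e.symm (s + r) := fun r => e.symm.monotone le_self_add
  let e' : ℝ≥0 ≃o ℝ≥0 :=
    { toFun := fun v => e (e.symm s + v) - s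
      invFun := fun r => e.symm (s + r) - e.symm s
      left_inv := fun v => by
        dsimp only
        rw [add_tsub_cancel_of_le (hle v), e.symm_apply_apply, add_tsub_cancel_left]
      right_inv := fun r => by
        dsimp only
        rw [add_tsub_cancel_of_le (hle' r), e.apply_symm_apply, add_tsub_cancel_left]
      map_rel_iff' := fun {v w} => by
        change e (e.symm s + v) - s ≤ e (e.symm s + w) - s ↔ v ≤ w
        rw [tsub_le_tsub_iff_right (hle w), e.le_iff_le, add_le_add_iff_left] }
  have hX' : ∀ v, clockShift s X v = pathShift s b (e' v) := fun v => by
    change X (invClock X s + v) = b (s + (e (e.symm s + v) - s))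
    rw [add_tsub_cancel_of_le (hle v), hX, hinv]
  have hclk' := clock_eq_of_timeChange hX' hbs
  refine ⟨⟨e, hclk⟩, ⟨e', hclk'⟩, fun r => ?_⟩
  rw [invClock_eq_symm hclk', hinv, hinv]
  change _ = e.symm s + (e.symm (s + r) - e.symm s)
  rw [add_tsub_cancel_of_le (hle' r)]

end TimeChange

section Realization

variable {Ω : Type*} [MeasurableSpace Ω] {μ : Measure Ω}
  {B : ℝ≥0 → Ω → ℂ} {τ : ℝ≥0 → Ω → ℝ≥0} {z : ℂ} {F G : Ω → PathSp}

lemma ae_clock_of_isPlanarBM [IsProbabilityMeasure μ] (hB : IsPlanarBM μ B z) (hG : Measurable G)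
    (hGB : ∀ᵐ ω ∂μ, ∀ s : ℝ≥0, G ω s = B s ω) : ∀ᵐ ω ∂μ, ∀ t : ℝ≥0, clock (G ω) t = t := by
  have := Measure.isProbabilityMeasure_map (μ := μ) hG.aemeasurable
  exact ae_of_ae_map hG.aemeasurable (ae_clock_eq (hB.hasBrownianIncrements hG hGB))

lemma ae_clock_pathShift_of_isPlanarBM [IsProbabilityMeasure μ] (hB : IsPlanarBM μ B z)
    (hG : Measurable G) (hGB : ∀ᵐ ω ∂μ, ∀ s : ℝ≥0, G ω s = B s ω) (s : ℝ≥0) :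
    ∀ᵐ ω ∂μ, ∀ t : ℝ≥0, clock (pathShift s (G ω)) t = t := by
  have := Measure.isProbabilityMeasure_map (μ := μ) hG.aemeasurable
  have := Measure.isProbabilityMeasure_map (μ := μ.map G) (measurable_pathShift s).aemeasurable
  exact ae_of_ae_map hG.aemeasurable (ae_of_ae_map (measurable_pathShift s).aemeasurable
    (ae_clock_eq ((hB.hasBrownianIncrements hG hGB).map_pathShift s)))

lemma ae_exists_orderIso
    (hτ : ∀ᵐ ω ∂μ, τ 0 ω = 0 ∧ StrictMono (fun u => τ u ω) ∧
      Continuous (fun u => τ u ω) ∧ Tendsto (fun u => τ u ω) atTop atTop)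
    (hFB : ∀ᵐ ω ∂μ, ∀ u : ℝ≥0, F ω u = B (τ u ω) ω)
    (hGB : ∀ᵐ ω ∂μ, ∀ s : ℝ≥0, G ω s = B s ω) :
    ∀ᵐ ω ∂μ, ∃ e : ℝ≥0 ≃o ℝ≥0, (∀ u, τ u ω = e u) ∧ ∀ u, F ω u = G ω (e u) := by
  filter_upwards [hτ, hFB, hGB] with ω ⟨h0, hm, hc, ht⟩ hF hG
  obtain ⟨e, he⟩ := exists_orderIso_of_continuous_strictMono h0 hm hc fun y =>
    (ht.eventually_ge_atTop y).exists
  exact ⟨e, he, fun u => by rw [hF, hG, he]⟩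

end Realization

lemma ae_isShiftClocked {P : ℂ → ProbabilityMeasure PathSp} (hP : IsTimeChangedBM P) (w : ℂ)
    (s : ℝ≥0) : ∀ᵐ X ∂(P w : Measure PathSp), IsShiftClocked s X := by
  obtain ⟨Ω, mΩ, μ, B, τ, F, hμ, hB, hτ, hF, hFB, hlaw⟩ := hP w
  obtain ⟨G, hG, hGB⟩ := hB.exists_path
  rw [← hlaw, ae_map_iff hF.aemeasurable (measurableSet_isShiftClocked s)]
  filter_upwards [ae_exists_orderIso hτ hFB hGB, ae_clock_of_isPlanarBM hB hG hGB,
    ae_clock_pathShift_of_isPlanarBM hB hG hGB s] with ω ⟨e, _, he⟩ h1 h2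
  exact isShiftClocked_of_timeChange he h1 h2

/-! ### The strong Markov property at inverse clock times -/

/-- The event `S` is determined by the path up to the time at which its clock reaches `s`. -/
structure IsClockPast (s : ℝ≥0) (S : Set PathSp) : Prop where
  measurableSet : MeasurableSet S
  mem_iff : ∀ (u : ℝ≥0) (X : PathSp), (s : ℝ≥0∞) ≤ clock X u → (X ∈ S ↔ stopPath u X ∈ S)

section StrongMarkov

variable {P : ℂ → ProbabilityMeasure PathSp}

lemma IsMarkovian.measure_inter (hM : IsMarkovian P) (hPc : Continuous P) (w : ℂ) (u : ℝ≥0)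
    {A : Set PathSp} (hA : MeasurableSet[pastAlg u] A) {H : Set PathSp} (hH : MeasurableSet H) :
    (P w : Measure PathSp) (A ∩ pathShift u ⁻¹' H) =
      ∫⁻ X in A, (P (X u) : Measure PathSp) H ∂(P w : Measure PathSp) := by
  have hPm := measurable_of_continuous_probabilityMeasure hPc
  have hA' := pastAlg_le u A hA
  have h := hM w u A hA (H.indicator 1) (measurable_one.indicator hH)
    ⟨1, fun X => by by_cases hX : X ∈ H <;> simp [hX]⟩
  have h1 : ∀ X : PathSp, H.indicator (1 : PathSp → ℝ) (pathShift u X) =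
      (pathShift u ⁻¹' H).indicator 1 X := fun X => rfl
  simp_rw [h1] at h
  rw [integral_indicator_one (measurable_pathShift u hH)] at h
  simp_rw [integral_indicator_one hH] at h
  simp only [measureReal_def] at h
  have hm : Measurable fun X : PathSp => (P (X u) : Measure PathSp) H :=
    (Measure.measurable_coe hH).comp (hPm.comp (measurable_eval_path u))
  rw [integral_toReal hm.aemeasurable
    (Eventually.of_forall fun X => measure_lt_top _ _),
    Measure.restrict_apply (measurable_pathShift u hH), Set.inter_comm] at h
  refine (ENNReal.toReal_eq_toReal_iff' (measure_ne_top _ _) ?_).1 h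
  refine ne_top_of_le_ne_top ENNReal.one_ne_top ?_
  calc _ ≤ ∫⁻ X in A, 1 ∂(P w : Measure PathSp) := lintegral_mono fun X => prob_le_one
    _ ≤ 1 := by rw [setLIntegral_one]; exact prob_le_one

lemma IsMarkovian.setLIntegral (hM : IsMarkovian P) (hPc : Continuous P) (w : ℂ) (u : ℝ≥0)
    {A : Set PathSp} (hA : MeasurableSet[pastAlg u] A) {f : PathSp → ℝ≥0∞} (hf : Measurable f) :
    ∫⁻ X in A, f (pathShift u X) ∂(P w : Measure PathSp) =
      ∫⁻ X in A, ∫⁻ Y, f Y ∂(P (X u) : Measure PathSp) ∂(P w : Measure PathSp) := by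
  have hPm := measurable_of_continuous_probabilityMeasure hPc
  have hPm' : Measurable fun X : PathSp => (P (X u) : Measure PathSp) :=
    hPm.comp (measurable_eval_path u)
  have hA' := pastAlg_le u A hA
  have h : ((P w : Measure PathSp).restrict A).map (pathShift u) =
      ((P w : Measure PathSp).restrict A).bind fun X => (P (X u) : Measure PathSp) := by
    ext H hH
    rw [Measure.map_apply (measurable_pathShift u) hH,
      Measure.restrict_apply (measurable_pathShift u hH), Set.inter_comm,
      hM.measure_inter hPc w u hA hH, Measure.bind_apply hH hPm'.aemeasurable]
  rw [← lintegral_map hf (measurable_pathShift u), h,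
    Measure.lintegral_bind hPm'.aemeasurable hf.aemeasurable]

/-- Dyadic approximation from above of the inverse clock. -/
def dyadicInvClock (s : ℝ≥0) (n : ℕ) (X : PathSp) : ℝ≥0 := ⌈invClock X s * 2 ^ n⌉₊ / 2 ^ n

lemma le_dyadicInvClock (s : ℝ≥0) (n : ℕ) (X : PathSp) :
    invClock X s ≤ dyadicInvClock s n X := by
  rw [dyadicInvClock, le_div_iff₀ (by positivity)]
  exact Nat.le_ceil _

lemma dyadicInvClock_le (s : ℝ≥0) (n : ℕ) (X : PathSp) :
    dyadicInvClock s n X ≤ invClock X s + 1 / 2 ^ n := by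
  rw [dyadicInvClock, div_le_iff₀ (by positivity), add_mul, one_div,
    inv_mul_cancel₀ (by positivity)]
  exact (Nat.ceil_lt_add_one zero_le).le

lemma tendsto_dyadicInvClock (s : ℝ≥0) (X : PathSp) :
    Tendsto (fun n => dyadicInvClock s n X) atTop (𝓝 (invClock X s)) := by
  refine tendsto_of_tendsto_of_tendsto_of_le_of_le tendsto_const_nhds ?_
    (fun n => le_dyadicInvClock s n X) (fun n => dyadicInvClock_le s n X)
  have h : Tendsto (fun n : ℕ => (1 : ℝ≥0) / 2 ^ n) atTop (𝓝 0) := by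
    simp_rw [one_div, ← inv_pow]
    refine NNReal.tendsto_pow_atTop_nhds_zero_of_lt_one ?_
    rw [← NNReal.coe_lt_coe]
    norm_num
  simpa using h.const_add (invClock X s)

lemma measurable_natCeil_invClock (s : ℝ≥0) (n : ℕ) :
    Measurable fun X : PathSp => ⌈invClock X s * 2 ^ n⌉₊ :=
  Nat.measurable_ceil.comp ((measurable_invClock s).mul_const ((2 : ℝ≥0) ^ n))

lemma measurable_dyadicInvClock (s : ℝ≥0) (n : ℕ) : Measurable (dyadicInvClock s n) := by
  exact ((measurable_from_nat (f := fun k : ℕ => (k : ℝ≥0))).comp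
    (measurable_natCeil_invClock s n)).div_const _

/-- The event that the dyadic approximation of the inverse clock equals `k / 2ⁿ`. -/
def dyadicEvent (s : ℝ≥0) (n k : ℕ) : Set PathSp :=
  {X | (s : ℝ≥0∞) ≤ clock X (k / 2 ^ n) ∧ ⌈invClock X s * 2 ^ n⌉₊ = k}

lemma IsClockPast.inter_dyadicEvent {s : ℝ≥0} {S : Set PathSp} (hS : IsClockPast s S) (n k : ℕ) :
    MeasurableSet[pastAlg (k / 2 ^ n)] (S ∩ dyadicEvent s n k) := by
  have hm : MeasurableSet (S ∩ dyadicEvent s n k) := by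
    refine hS.1.inter ((measurableSet_le measurable_const (measurable_clock _)).inter ?_)
    exact (measurable_natCeil_invClock s n) (measurableSet_singleton k)
  have hset : S ∩ dyadicEvent s n k = stopPath (k / 2 ^ n) ⁻¹' (S ∩ dyadicEvent s n k) := by
    ext X
    simp only [dyadicEvent, Set.mem_inter_iff, Set.mem_ofPred_eq, Set.mem_preimage,
      clock_stopPath X (le_refl (k / 2 ^ n : ℝ≥0))]
    constructor
    · rintro ⟨h1, h2, h3⟩
      exact ⟨(hS.2 _ X h2).1 h1, h2, by rwa [invClock_stopPath le_rfl h2]⟩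
    · rintro ⟨h1, h2, h3⟩
      exact ⟨(hS.2 _ X h2).2 h1, h2, by rwa [invClock_stopPath le_rfl h2] at h3⟩
  rw [hset]
  exact measurable_stopPath _ hm

lemma setLIntegral_dyadicInvClock (hPc : Continuous P) (hM : IsMarkovian P)
    (hT : IsTimeChangedBM P) (w : ℂ) {s : ℝ≥0} {S : Set PathSp} (hS : IsClockPast s S) (n : ℕ)
    {f : PathSp → ℝ≥0∞} (hf : Measurable f) :
    ∫⁻ X in S, f (pathShift (dyadicInvClock s n X) X) ∂(P w : Measure PathSp) =
      ∫⁻ X in S, ∫⁻ Y, f Y ∂(P (X (dyadicInvClock s n X)) : Measure PathSp)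
        ∂(P w : Measure PathSp) := by
  have hae : (S : Set PathSp) =ᵐ[(P w : Measure PathSp)] ⋃ k, S ∩ dyadicEvent s n k := by
    rw [← Set.inter_iUnion]
    filter_upwards [ae_isShiftClocked hT w s] with X hX
    have : X ∈ ⋃ k, dyadicEvent s n k := by
      refine Set.mem_iUnion.2 ⟨_, ?_, rfl⟩
      calc (s : ℝ≥0∞) = clock X (invClock X s) := (hX.1.clock_invClock s).symm
        _ ≤ _ := clock_mono X (le_dyadicInvClock s n X)
    exact propext ⟨fun h => ⟨h, this⟩, fun h => h.1⟩
  have hmeas : ∀ k, MeasurableSet (S ∩ dyadicEvent s n k) := fun k =>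
    pastAlg_le _ _ (hS.inter_dyadicEvent n k)
  have hdisj : Pairwise (Function.onFun Disjoint fun k => S ∩ dyadicEvent s n k) := by
    intro k l hkl
    refine Set.disjoint_left.2 fun X h1 h2 => hkl ?_
    rw [← h1.2.2, ← h2.2.2]
  rw [setLIntegral_congr hae, setLIntegral_congr hae, lintegral_iUnion hmeas hdisj,
    lintegral_iUnion hmeas hdisj]
  congr 1
  funext k
  have hk : ∀ X ∈ S ∩ dyadicEvent s n k, dyadicInvClock s n X = k / 2 ^ n := fun X hX => by
    rw [dyadicInvClock, hX.2.2]
  rw [setLIntegral_congr_fun (hmeas k) (fun X hX => by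
      rw [hk X hX]),
    hM.setLIntegral hPc w _ (hS.inter_dyadicEvent n k) hf]
  exact setLIntegral_congr_fun (hmeas k) (fun X hX => by rw [hk X hX])

lemma setLIntegral_clockShift (hPc : Continuous P) (hM : IsMarkovian P)
    (hT : IsTimeChangedBM P) (w : ℂ) {s : ℝ≥0} {S : Set PathSp} (hS : IsClockPast s S)
    (f : BoundedContinuousFunction PathSp ℝ≥0) :
    ∫⁻ X in S, f (clockShift s X) ∂(P w : Measure PathSp) =
      ∫⁻ X in S, ∫⁻ Y, f Y ∂(P (unitPath X s) : Measure PathSp) ∂(P w : Measure PathSp) := by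
  have hfm : Measurable fun X => (f X : ℝ≥0∞) := f.continuous.measurable.coe_nnreal_ennreal
  have hg : Continuous fun v : ℂ => ∫⁻ Y, f Y ∂(P v : Measure PathSp) :=
    continuous_iff_continuousAt.2 fun v =>
      (ProbabilityMeasure.tendsto_iff_forall_lintegral_tendsto.1 (hPc.tendsto v)) f
  obtain ⟨C, hC⟩ : ∃ C : ℝ≥0, ∀ X, f X ≤ C := ⟨nndist f 0, fun X => by
    have := f.nndist_coe_le_nndist (g := 0) X
    simpa [NNReal.nndist_zero_eq_val'] using this⟩
  have hgC : ∀ v, ∫⁻ Y, f Y ∂(P v : Measure PathSp) ≤ C := fun v => by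
    calc _ ≤ ∫⁻ _, (C : ℝ≥0∞) ∂(P v : Measure PathSp) :=
          lintegral_mono fun Y => ENNReal.coe_le_coe.2 (hC Y)
      _ = C := by simp
  have hfin : ∫⁻ _ in S, (C : ℝ≥0∞) ∂(P w : Measure PathSp) ≠ ∞ := by
    simp [ENNReal.mul_eq_top]
  have l1 : Tendsto (fun n => ∫⁻ X in S, (f (pathShift (dyadicInvClock s n X) X) : ℝ≥0∞)
      ∂(P w : Measure PathSp)) atTop
      (𝓝 (∫⁻ X in S, f (clockShift s X) ∂(P w : Measure PathSp))) := by
    refine tendsto_lintegral_of_dominated_convergence (fun _ => (C : ℝ≥0∞)) (fun n => ?_)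
      (fun n => Eventually.of_forall fun X => ENNReal.coe_le_coe.2 (hC _)) hfin
      (Eventually.of_forall fun X => ?_)
    · exact hfm.comp (measurable_pathShift_comp (measurable_dyadicInvClock s n) measurable_id)
    · refine ENNReal.tendsto_coe.2 ((f.continuous.tendsto _).comp ?_)
      exact (continuous_pathShift.tendsto (invClock X s, X)).comp
        ((tendsto_dyadicInvClock s X).prodMk_nhds tendsto_const_nhds)
  have l2 : Tendsto (fun n => ∫⁻ X in S, ∫⁻ Y, f Y
      ∂(P (X (dyadicInvClock s n X)) : Measure PathSp) ∂(P w : Measure PathSp)) atTop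
      (𝓝 (∫⁻ X in S, ∫⁻ Y, f Y ∂(P (unitPath X s) : Measure PathSp)
        ∂(P w : Measure PathSp))) := by
    refine tendsto_lintegral_of_dominated_convergence (fun _ => (C : ℝ≥0∞)) (fun n => ?_)
      (fun n => Eventually.of_forall fun X => hgC _) hfin
      (Eventually.of_forall fun X => ?_)
    · exact hg.measurable.comp
        (measurable_eval_comp (measurable_dyadicInvClock s n) measurable_id)
    · refine (hg.tendsto _).comp ?_
      exact (X.continuous.tendsto _).comp (tendsto_dyadicInvClock s X)
  refine tendsto_nhds_unique l1 (l2.congr fun n => ?_)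
  exact (setLIntegral_dyadicInvClock hPc hM hT w hS n hfm).symm

lemma measurable_unitPath_apply (s : ℝ≥0) : Measurable fun X => unitPath X s :=
  (measurable_pi_apply s).comp measurable_unitPath

lemma measure_inter_clockShift (hPc : Continuous P) (hM : IsMarkovian P)
    (hT : IsTimeChangedBM P) (w : ℂ) {s : ℝ≥0} {S : Set PathSp} (hS : IsClockPast s S)
    {H : Set PathSp} (hH : MeasurableSet H) :
    (P w : Measure PathSp) (S ∩ clockShift s ⁻¹' H) =
      ∫⁻ X in S, (P (unitPath X s) : Measure PathSp) H ∂(P w : Measure PathSp) := by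
  have hPm' : Measurable fun X : PathSp => (P (unitPath X s) : Measure PathSp) :=
    (measurable_of_continuous_probabilityMeasure hPc).comp (measurable_unitPath_apply s)
  have h : ((P w : Measure PathSp).restrict S).map (clockShift s) =
      ((P w : Measure PathSp).restrict S).bind fun X => (P (unitPath X s) : Measure PathSp) := by
    refine ext_of_forall_lintegral_eq_of_IsFiniteMeasure fun f => ?_
    have hfm : Measurable fun X => (f X : ℝ≥0∞) := f.continuous.measurable.coe_nnreal_ennreal
    rw [lintegral_map hfm (measurable_clockShift s),
      Measure.lintegral_bind hPm'.aemeasurable hfm.aemeasurable]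
    exact setLIntegral_clockShift hPc hM hT w hS f
  have := congrArg (fun ρ => ρ H) h
  rwa [Measure.map_apply (measurable_clockShift s) hH,
    Measure.restrict_apply (measurable_clockShift s hH), Set.inter_comm,
    Measure.bind_apply hH hPm'.aemeasurable] at this

end StrongMarkov

/-! ### Conditional expectations of nonnegative functions given a random variable -/

section CondLExp

variable {Ω W : Type*} [MeasurableSpace Ω] [MeasurableSpace W]

/-- `h ∘ U` is a version of the conditional expectation of `G` given `U`. -/
structure IsCondLExp (Q : Measure Ω) (U : Ω → W) (G : Ω → ℝ≥0∞) (h : W → ℝ≥0∞) : Prop where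
  measurable : Measurable h
  setLIntegral : ∀ E : Set W, MeasurableSet E →
    ∫⁻ X in U ⁻¹' E, G X ∂Q = ∫⁻ X in U ⁻¹' E, h (U X) ∂Q

variable {Q : Measure Ω} {U : Ω → W} {G G' : Ω → ℝ≥0∞} {h h' : W → ℝ≥0∞}

lemma IsCondLExp.measurable_comp (hh : IsCondLExp Q U G h) (hU : Measurable U) :
    Measurable fun X => h (U X) :=
  hh.measurable.comp hU

lemma IsCondLExp.lintegral_mul (hh : IsCondLExp Q U G h) (hU : Measurable U) (hG : Measurable G)
    {k : W → ℝ≥0∞} (hk : Measurable k) :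
    ∫⁻ X, k (U X) * G X ∂Q = ∫⁻ X, k (U X) * h (U X) ∂Q := by
  have e : (Q.withDensity G).map U = (Q.withDensity (h ∘ U)).map U := by
    ext E hE
    rw [Measure.map_apply hU hE, Measure.map_apply hU hE, withDensity_apply _ (hU hE),
      withDensity_apply _ (hU hE)]
    exact hh.setLIntegral E hE
  have e2 := congrArg (fun ν => ∫⁻ p, k p ∂ν) e
  simp only [lintegral_map hk hU] at e2
  have hkU : Measurable fun X => k (U X) := hk.comp hU
  rw [lintegral_withDensity_eq_lintegral_mul _ hG hkU,
    lintegral_withDensity_eq_lintegral_mul _ (hh.measurable.comp hU) hkU] at e2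
  simp only [Pi.mul_apply, Function.comp_apply] at e2
  simpa only [mul_comm] using e2

lemma IsCondLExp.lintegral (hh : IsCondLExp Q U G h) :
    ∫⁻ X, G X ∂Q = ∫⁻ X, h (U X) ∂Q := by
  simpa using hh.setLIntegral Set.univ MeasurableSet.univ

lemma IsCondLExp.congr (hh : IsCondLExp Q U G h) (hG : G =ᵐ[Q] G') : IsCondLExp Q U G' h :=
  ⟨hh.measurable, fun E hE => by
    rw [← hh.setLIntegral E hE]
    exact lintegral_congr_ae (ae_restrict_of_ae (hG.mono fun _ h => h.symm))⟩

lemma IsCondLExp.const (Q : Measure Ω) (U : Ω → W) (c : ℝ≥0∞) :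
    IsCondLExp Q U (fun _ => c) fun _ => c :=
  ⟨measurable_const, fun _ _ => rfl⟩

lemma IsCondLExp.add (hh : IsCondLExp Q U G h) (hh' : IsCondLExp Q U G' h') (hU : Measurable U)
    (hG : Measurable G) : IsCondLExp Q U (fun X => G X + G' X) fun p => h p + h' p :=
  ⟨hh.measurable.add hh'.measurable, fun E hE => by
    rw [lintegral_add_left hG, lintegral_add_left (hh.measurable_comp hU), hh.setLIntegral E hE,
      hh'.setLIntegral E hE]⟩

lemma IsCondLExp.const_mul (hh : IsCondLExp Q U G h) (hU : Measurable U) (hG : Measurable G)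
    (c : ℝ≥0∞) : IsCondLExp Q U (fun X => c * G X) fun p => c * h p :=
  ⟨hh.measurable.const_mul c, fun E hE => by
    rw [lintegral_const_mul _ hG, lintegral_const_mul c (hh.measurable_comp hU),
      hh.setLIntegral E hE]⟩

lemma exists_isCondLExp [IsFiniteMeasure Q] (hU : Measurable U) (hG1 : ∀ X, G X ≤ 1) :
    ∃ h, IsCondLExp Q U G h := by
  have hfin : IsFiniteMeasure (Q.withDensity G) := by
    refine isFiniteMeasure_withDensity (ne_top_of_le_ne_top (measure_ne_top Q Set.univ) ?_)
    calc _ ≤ ∫⁻ _, 1 ∂Q := lintegral_mono hG1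
      _ = _ := by simp
  have hac : (Q.withDensity G).map U ≪ Q.map U :=
    (withDensity_absolutelyContinuous Q G).map hU
  refine ⟨((Q.withDensity G).map U).rnDeriv (Q.map U), Measure.measurable_rnDeriv _ _,
    fun E hE => ?_⟩
  have e := congrArg (fun ν => ν E) (Measure.withDensity_rnDeriv_eq _ _ hac)
  simp only [withDensity_apply _ hE, Measure.map_apply hU hE] at e
  rw [withDensity_apply _ (hU hE)] at e
  rw [← e, setLIntegral_map hE (Measure.measurable_rnDeriv _ _) hU]

lemma IsCondLExp.mono [IsFiniteMeasure Q] (hh : IsCondLExp Q U G h)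
    (hh' : IsCondLExp Q U G' h') (hU : Measurable U) (hG : ∀ᵐ X ∂Q, G X ≤ G' X) :
    ∀ᵐ X ∂Q, h (U X) ≤ h' (U X) := by
  refine ae_of_ae_map hU.aemeasurable (p := fun p => h p ≤ h' p) ?_
  refine ae_le_of_forall_setLIntegral_le_of_sigmaFinite hh.measurable fun E hE _ => ?_
  rw [setLIntegral_map hE hh.measurable hU, setLIntegral_map hE hh'.measurable hU,
    ← hh.setLIntegral E hE, ← hh'.setLIntegral E hE]
  exact lintegral_mono_ae (ae_restrict_of_ae hG)

lemma IsCondLExp.unique [IsFiniteMeasure Q] (hh : IsCondLExp Q U G h)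
    (hh' : IsCondLExp Q U G h') (hU : Measurable U) : ∀ᵐ X ∂Q, h (U X) = h' (U X) := by
  filter_upwards [hh.mono hh' hU (Eventually.of_forall fun _ => le_rfl),
    hh'.mono hh hU (Eventually.of_forall fun _ => le_rfl)] with X h1 h2
  exact le_antisymm h1 h2

end CondLExp

/-! ### Mixtures over the starting point -/

/-- The law of the path when its starting point has distribution `m`. -/
def mixture (P : ℂ → ProbabilityMeasure PathSp) (m : Measure ℂ) : Measure PathSp :=
  m.bind fun w => (P w : Measure PathSp)

/-- The function `G` of the path is determined by the path up to the time at which its clock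
reaches `s`. -/
structure IsClockPastFun {β : Type*} [MeasurableSpace β] (s : ℝ≥0) (G : PathSp → β) : Prop where
  measurable : Measurable G
  stopPath_eq : ∀ (u : ℝ≥0) (X : PathSp), (s : ℝ≥0∞) ≤ clock X u → G (stopPath u X) = G X

lemma IsClockPastFun.preimage {β : Type*} [MeasurableSpace β] {s : ℝ≥0} {G : PathSp → β}
    (hG : IsClockPastFun s G) {S : Set β} (hS : MeasurableSet S) : IsClockPast s (G ⁻¹' S) :=
  ⟨hG.measurable hS, fun u X h => by
    rw [Set.mem_preimage, Set.mem_preimage, hG.stopPath_eq u X h]⟩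

section Mixture

variable {P : ℂ → ProbabilityMeasure PathSp} {m : Measure ℂ}

lemma lintegral_mixture (hPc : Continuous P) {K : PathSp → ℝ≥0∞} (hK : Measurable K) :
    ∫⁻ X, K X ∂mixture P m = ∫⁻ w, ∫⁻ X, K X ∂(P w : Measure PathSp) ∂m :=
  Measure.lintegral_bind (measurable_of_continuous_probabilityMeasure hPc).aemeasurable
    hK.aemeasurable

lemma mixture_apply (hPc : Continuous P) {S : Set PathSp} (hS : MeasurableSet S) :
    mixture P m S = ∫⁻ w, (P w : Measure PathSp) S ∂m :=
  Measure.bind_apply hS (measurable_of_continuous_probabilityMeasure hPc).aemeasurable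

lemma isFiniteMeasure_mixture (hPc : Continuous P) [IsFiniteMeasure m] :
    IsFiniteMeasure (mixture P m) :=
  ⟨by rw [mixture_apply hPc MeasurableSet.univ]; simp⟩

lemma ae_mixture (hPc : Continuous P) {p : PathSp → Prop} (hp : MeasurableSet {X | p X})
    (h : ∀ w, ∀ᵐ X ∂(P w : Measure PathSp), p X) : ∀ᵐ X ∂mixture P m, p X := by
  rw [ae_iff, ← Set.compl_ofPred, mixture_apply hPc hp.compl]
  have : ∀ w, (P w : Measure PathSp) {X | p X}ᶜ = 0 := fun w => h w
  simp [this]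

lemma measurable_lintegral_start (hPc : Continuous P) {K : PathSp → ℝ≥0∞} (hK : Measurable K) :
    Measurable fun w => ∫⁻ X, K X ∂(P w : Measure PathSp) :=
  (Measure.measurable_lintegral hK).comp (measurable_of_continuous_probabilityMeasure hPc)

lemma mixture_inter_clockShift (hPc : Continuous P) (hM : IsMarkovian P)
    (hT : IsTimeChangedBM P) {s : ℝ≥0} {S : Set PathSp} (hS : IsClockPast s S)
    {H : Set PathSp} (hH : MeasurableSet H) :
    mixture P m (S ∩ clockShift s ⁻¹' H) =
      ∫⁻ X in S, (P (unitPath X s) : Measure PathSp) H ∂mixture P m := by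
  have hm : Measurable fun X : PathSp => (P (unitPath X s) : Measure PathSp) H :=
    (Measure.measurable_coe hH).comp
      ((measurable_of_continuous_probabilityMeasure hPc).comp (measurable_unitPath_apply s))
  rw [mixture_apply hPc (hS.1.inter (measurable_clockShift s hH)),
    ← lintegral_indicator hS.1, lintegral_mixture hPc (hm.indicator hS.1)]
  simp_rw [lintegral_indicator hS.1]
  exact lintegral_congr fun w => measure_inter_clockShift hPc hM hT w hS hH

lemma map_clockShift_mixture (hPc : Continuous P) (hM : IsMarkovian P)
    (hT : IsTimeChangedBM P) (s : ℝ≥0) :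
    (mixture P m).map (clockShift s) =
      mixture P ((mixture P m).map fun X => unitPath X s) := by
  ext H hH
  have hS : IsClockPast s Set.univ := ⟨MeasurableSet.univ, fun _ _ _ => by simp⟩
  have h := mixture_inter_clockShift (m := m) hPc hM hT hS hH
  rw [Set.univ_inter, Measure.restrict_univ] at h
  rw [Measure.map_apply (measurable_clockShift s) hH, h, mixture_apply hPc hH,
    lintegral_map _ (measurable_unitPath_apply s)]
  exact (Measure.measurable_coe hH).comp (measurable_of_continuous_probabilityMeasure hPc)

lemma lintegral_mul_clockShift (hPc : Continuous P) (hM : IsMarkovian P)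
    (hT : IsTimeChangedBM P) {s : ℝ≥0} {G : PathSp → ℝ≥0∞}
    (hG : IsClockPastFun s G) {K : PathSp → ℝ≥0∞} (hK : Measurable K) :
    ∫⁻ X, G X * K (clockShift s X) ∂mixture P m =
      ∫⁻ X, G X * ∫⁻ Y, K Y ∂(P (unitPath X s) : Measure PathSp) ∂mixture P m := by
  have hPm' : Measurable fun X : PathSp => (P (unitPath X s) : Measure PathSp) :=
    (measurable_of_continuous_probabilityMeasure hPc).comp (measurable_unitPath_apply s)
  have hk : Measurable fun X => ∫⁻ Y, K Y ∂(P (unitPath X s) : Measure PathSp) :=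
    (measurable_lintegral_start hPc hK).comp (measurable_unitPath_apply s)
  have hKs : Measurable fun X => K (clockShift s X) := hK.comp (measurable_clockShift s)
  have e1 : ∀ S, IsClockPast s S → ∫⁻ X in S, K (clockShift s X) ∂mixture P m =
      ∫⁻ X in S, ∫⁻ Y, K Y ∂(P (unitPath X s) : Measure PathSp) ∂mixture P m := by
    intro S hS
    have h : ((mixture P m).restrict S).map (clockShift s) =
        ((mixture P m).restrict S).bind fun X => (P (unitPath X s) : Measure PathSp) := by
      ext H hH
      rw [Measure.map_apply (measurable_clockShift s) hH,
        Measure.restrict_apply (measurable_clockShift s hH), Set.inter_comm,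
        mixture_inter_clockShift hPc hM hT hS hH, Measure.bind_apply hH hPm'.aemeasurable]
    rw [← lintegral_map hK (measurable_clockShift s), h,
      Measure.lintegral_bind hPm'.aemeasurable hK.aemeasurable]
  have e2 : ((mixture P m).withDensity fun X => K (clockShift s X)).map G =
      ((mixture P m).withDensity
        fun X => ∫⁻ Y, K Y ∂(P (unitPath X s) : Measure PathSp)).map G := by
    ext S hS
    rw [Measure.map_apply hG.measurable hS, Measure.map_apply hG.measurable hS,
      withDensity_apply _ (hG.measurable hS), withDensity_apply _ (hG.measurable hS)]
    exact e1 _ (hG.preimage hS)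
  have e3 := congrArg (fun ν => ∫⁻ x, x ∂ν) e2
  simp only [lintegral_map measurable_id' hG.measurable] at e3
  rw [lintegral_withDensity_eq_lintegral_mul _ hKs hG.measurable,
    lintegral_withDensity_eq_lintegral_mul _ hk hG.measurable] at e3
  simpa only [Pi.mul_apply, mul_comm] using e3

lemma ae_unitPath_zero (hS : StartsAt P) (hT : IsTimeChangedBM P) (w : ℂ) :
    ∀ᵐ X ∂(P w : Measure PathSp), unitPath X 0 = w := by
  have h0 : ∀ᵐ X ∂(P w : Measure PathSp), X 0 = w :=
    (prob_compl_eq_zero_iff ((measurable_eval_path 0) (measurableSet_singleton w))).2 (hS w)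
  filter_upwards [ae_isShiftClocked hT w 0, h0] with X hX h
  obtain ⟨e, he⟩ := hX.1
  rw [unitPath, invClock_eq_symm he]
  have : e.symm 0 = 0 := e.symm.map_bot
  rwa [this]

lemma ae_lintegral_eq_of_isCondLExp (hPc : Continuous P) (hS : StartsAt P)
    (hT : IsTimeChangedBM P) [IsFiniteMeasure m] {H : PathSp → ℝ≥0∞} {h : (ℝ≥0 → ℂ) → ℝ≥0∞}
    (hH : Measurable H) (hh : IsCondLExp (mixture P m) unitPath H h) {κ : (ℝ≥0 → ℂ) → ℝ≥0∞}
    (hκ : Measurable κ) :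
    ∀ᵐ w ∂m, ∫⁻ X, κ (unitPath X) * H X ∂(P w : Measure PathSp) =
      ∫⁻ X, κ (unitPath X) * h (unitPath X) ∂(P w : Measure PathSp) := by
  have hκu : Measurable fun X => κ (unitPath X) := hκ.comp measurable_unitPath
  have hhu : Measurable fun X => h (unitPath X) := hh.measurable.comp measurable_unitPath
  refine ae_eq_of_forall_setLIntegral_eq_of_sigmaFinite
    (measurable_lintegral_start hPc (hκu.mul hH))
    (measurable_lintegral_start hPc (hκu.mul hhu)) fun N hN _ => ?_
  have key : ∀ K : PathSp → ℝ≥0∞, Measurable K →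
      ∫⁻ w in N, ∫⁻ X, κ (unitPath X) * K X ∂(P w : Measure PathSp) ∂m =
        ∫⁻ X, (N.indicator 1 (unitPath X 0) * κ (unitPath X)) * K X ∂mixture P m := by
    intro K hK
    have h1 : Measurable fun X => N.indicator (1 : ℂ → ℝ≥0∞) (unitPath X 0) :=
      (measurable_one.indicator hN).comp (measurable_unitPath_apply 0)
    have h3 : Measurable fun X =>
        N.indicator (1 : ℂ → ℝ≥0∞) (unitPath X 0) * κ (unitPath X) * K X := (h1.mul hκu).mul hK
    rw [lintegral_mixture hPc h3, ← lintegral_indicator hN]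
    refine lintegral_congr fun w => ?_
    by_cases hw : w ∈ N
    · rw [Set.indicator_of_mem hw]
      refine lintegral_congr_ae ?_
      filter_upwards [ae_unitPath_zero hS hT w] with X hX
      rw [hX, Set.indicator_of_mem hw, Pi.one_apply, one_mul]
    · rw [Set.indicator_of_notMem hw, eq_comm, lintegral_eq_zero_iff h3]
      filter_upwards [ae_unitPath_zero hS hT w] with X hX
      simp [hX, hw]
  rw [key H hH, key _ hhu]
  refine hh.lintegral_mul measurable_unitPath hH
    (k := fun p => N.indicator 1 (p 0) * κ p) ?_
  exact ((measurable_one.indicator hN).comp (measurable_pi_apply 0)).mul hκ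

end Mixture

/-! ### Conditional independence of the pieces of the inverse clock -/

/-- The function `p` stopped at time `s`. -/
def stopFun (s : ℝ≥0) (p : ℝ≥0 → ℂ) : ℝ≥0 → ℂ := fun r => p (min r s)

/-- The function `p` shifted by time `s`. -/
def shiftFun (s : ℝ≥0) (p : ℝ≥0 → ℂ) : ℝ≥0 → ℂ := fun r => p (s + r)

/-- The function equal to `p` up to time `s` and to `q (· - s)` afterwards. -/
def glueFun (s : ℝ≥0) (x : (ℝ≥0 → ℂ) × (ℝ≥0 → ℂ)) : ℝ≥0 → ℂ :=
  fun r => if r ≤ s then x.1 r else x.2 (r - s)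

lemma measurable_stopFun (s : ℝ≥0) : Measurable (stopFun s) :=
  measurable_pi_lambda _ fun r => measurable_pi_apply (min r s)

lemma measurable_shiftFun (s : ℝ≥0) : Measurable (shiftFun s) :=
  measurable_pi_lambda _ fun r => measurable_pi_apply (s + r)

lemma measurable_glueFun (s : ℝ≥0) : Measurable (glueFun s) := by
  refine measurable_pi_lambda _ fun r => ?_
  by_cases hr : r ≤ s
  · simp only [glueFun, if_pos hr]
    exact (measurable_pi_apply r).comp measurable_fst
  · simp only [glueFun, if_neg hr]
    exact (measurable_pi_apply (r - s)).comp measurable_snd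

lemma glueFun_stopFun_shiftFun (s : ℝ≥0) (p : ℝ≥0 → ℂ) :
    glueFun s (stopFun s p, shiftFun s p) = p := by
  funext r
  by_cases hr : r ≤ s
  · simp [glueFun, stopFun, hr]
  · simp [glueFun, shiftFun, hr, add_tsub_cancel_of_le (not_le.1 hr).le]

lemma IsShiftClocked.shiftFun_unitPath {s : ℝ≥0} {X : PathSp} (h : IsShiftClocked s X) :
    shiftFun s (unitPath X) = unitPath (clockShift s X) :=
  funext fun r => h.unitPath_add r

lemma isClockPastFun_stopFun_unitPath (s : ℝ≥0) :
    IsClockPastFun s fun X => stopFun s (unitPath X) :=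
  ⟨(measurable_stopFun s).comp measurable_unitPath, fun _ _ h =>
    funext fun r => unitPath_stopPath (min_le_right r s) h⟩

section CondIndep

variable {P : ℂ → ProbabilityMeasure PathSp} {m : Measure ℂ}

lemma ae_mixture_isShiftClocked (hPc : Continuous P) (hT : IsTimeChangedBM P) (s : ℝ≥0) :
    ∀ᵐ X ∂mixture P m, IsShiftClocked s X :=
  ae_mixture hPc (measurableSet_isShiftClocked s) fun w => ae_isShiftClocked hT w s

lemma IsCondLExp.mul_clockShift (hPc : Continuous P) (hP : DefinesMTCBM P) [IsFiniteMeasure m]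
    {s : ℝ≥0} {G H : PathSp → ℝ≥0∞} {g h : (ℝ≥0 → ℂ) → ℝ≥0∞} (hG : IsClockPastFun s G)
    (hG1 : ∀ X, G X ≤ 1) (hH : Measurable H) (hH1 : ∀ X, H X ≤ 1)
    (hg : IsCondLExp (mixture P m) unitPath G g)
    (hh : IsCondLExp (mixture P ((mixture P m).map fun X => unitPath X s)) unitPath H h) :
    IsCondLExp (mixture P m) unitPath (fun X => G X * H (clockShift s X))
      fun p => g p * h (shiftFun s p) := by
  obtain ⟨hS, hM, hT⟩ := hP
  have := isFiniteMeasure_mixture (m := m) hPc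
  have hfin : IsFiniteMeasure ((mixture P m).map fun X => unitPath X s) :=
    Measure.isFiniteMeasure_map _ _
  have hU := measurable_unitPath
  have hUs := measurable_unitPath.comp (measurable_clockShift s)
  have hG' := hG.measurable
  have hmH : Measurable fun X => H (clockShift s X) := hH.comp (measurable_clockShift s)
  have hmh : Measurable fun p => h (shiftFun s p) := hh.measurable.comp (measurable_shiftFun s)
  have hshift := ae_mixture_isShiftClocked (m := m) hPc hT s
  have rect : ∀ κ₁ κ₂ : (ℝ≥0 → ℂ) → ℝ≥0∞, Measurable κ₁ → Measurable κ₂ →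
      ∫⁻ X, κ₁ (stopFun s (unitPath X)) * κ₂ (shiftFun s (unitPath X)) *
          (G X * H (clockShift s X)) ∂mixture P m =
        ∫⁻ X, κ₁ (stopFun s (unitPath X)) * κ₂ (shiftFun s (unitPath X)) *
          (g (unitPath X) * h (shiftFun s (unitPath X))) ∂mixture P m := by
    intro κ₁ κ₂ hκ₁ hκ₂
    have hpast : IsClockPastFun s fun X => κ₁ (stopFun s (unitPath X)) * G X := by
      refine ⟨((hκ₁.comp (measurable_stopFun s)).comp hU).mul hG', fun u X hu => ?_⟩
      have h1 := (isClockPastFun_stopFun_unitPath s).stopPath_eq u X hu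
      rw [h1, hG.stopPath_eq u X hu]
    calc _ = ∫⁻ X, (κ₁ (stopFun s (unitPath X)) * G X) *
          (κ₂ (unitPath (clockShift s X)) * H (clockShift s X)) ∂mixture P m := by
          refine lintegral_congr_ae ?_
          filter_upwards [hshift] with X hX
          rw [hX.shiftFun_unitPath]; ring
      _ = ∫⁻ X, (κ₁ (stopFun s (unitPath X)) * G X) *
          ∫⁻ Y, κ₂ (unitPath Y) * H Y ∂(P (unitPath X s) : Measure PathSp) ∂mixture P m :=
        lintegral_mul_clockShift hPc hM hT hpast (K := fun Y => κ₂ (unitPath Y) * H Y)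
          ((hκ₂.comp hU).mul hH)
      _ = ∫⁻ X, (κ₁ (stopFun s (unitPath X)) * G X) *
          ∫⁻ Y, κ₂ (unitPath Y) * h (unitPath Y) ∂(P (unitPath X s) : Measure PathSp)
            ∂mixture P m := by
          refine lintegral_congr_ae ?_
          filter_upwards [ae_of_ae_map (measurable_unitPath_apply s).aemeasurable
            (ae_lintegral_eq_of_isCondLExp hPc hS hT hH hh hκ₂)] with X hX
          rw [hX]
      _ = ∫⁻ X, (κ₁ (stopFun s (unitPath X)) * G X) *
          (κ₂ (unitPath (clockShift s X)) * h (unitPath (clockShift s X))) ∂mixture P m :=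
        (lintegral_mul_clockShift hPc hM hT hpast
          (K := fun Y => κ₂ (unitPath Y) * h (unitPath Y))
          ((hκ₂.comp hU).mul (hh.measurable.comp hU))).symm
      _ = ∫⁻ X, (κ₁ (stopFun s (unitPath X)) * (κ₂ (shiftFun s (unitPath X)) *
          h (shiftFun s (unitPath X)))) * G X ∂mixture P m := by
          refine lintegral_congr_ae ?_
          filter_upwards [hshift] with X hX
          rw [hX.shiftFun_unitPath]; ring
      _ = ∫⁻ X, (κ₁ (stopFun s (unitPath X)) * (κ₂ (shiftFun s (unitPath X)) *
          h (shiftFun s (unitPath X)))) * g (unitPath X) ∂mixture P m :=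
        hg.lintegral_mul hU hG'
          (k := fun p => κ₁ (stopFun s p) * (κ₂ (shiftFun s p) * h (shiftFun s p)))
          ((hκ₁.comp (measurable_stopFun s)).mul
            ((hκ₂.comp (measurable_shiftFun s)).mul hmh))
      _ = _ := lintegral_congr fun X => by ring
  have hmap : Measurable fun X => (stopFun s (unitPath X), shiftFun s (unitPath X)) :=
    ((measurable_stopFun s).comp hU).prodMk ((measurable_shiftFun s).comp hU)
  have hm1 : Measurable fun X => G X * H (clockShift s X) := hG'.mul hmH
  have hm2 : Measurable fun p => g p * h (shiftFun s p) := hg.measurable.mul hmh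
  have hm2U : Measurable fun X => g (unitPath X) * h (shiftFun s (unitPath X)) := hm2.comp hU
  have hfin1 : IsFiniteMeasure
      ((mixture P m).withDensity fun X => G X * H (clockShift s X)) := by
    refine isFiniteMeasure_withDensity
      (ne_top_of_le_ne_top (measure_ne_top (mixture P m) Set.univ) ?_)
    calc _ ≤ ∫⁻ _, 1 ∂mixture P m := lintegral_mono fun X => mul_le_one' (hG1 X) (hH1 _)
      _ = _ := by simp
  have hν : ((mixture P m).withDensity fun X => G X * H (clockShift s X)).map
      (fun X => (stopFun s (unitPath X), shiftFun s (unitPath X))) =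
      ((mixture P m).withDensity fun X => g (unitPath X) * h (shiftFun s (unitPath X))).map
      (fun X => (stopFun s (unitPath X), shiftFun s (unitPath X))) := by
    have : IsFiniteMeasure (((mixture P m).withDensity fun X => G X * H (clockShift s X)).map
      (fun X => (stopFun s (unitPath X), shiftFun s (unitPath X)))) :=
      Measure.isFiniteMeasure_map _ _
    refine Measure.ext_prod fun {A D} hA hD => ?_
    have hAD := hmap (hA.prod hD)
    have e := rect (A.indicator 1) (D.indicator 1) (measurable_one.indicator hA)
      (measurable_one.indicator hD)
    rw [Measure.map_apply hmap (hA.prod hD), Measure.map_apply hmap (hA.prod hD),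
      withDensity_apply _ hAD, withDensity_apply _ hAD, ← lintegral_indicator hAD,
      ← lintegral_indicator hAD]
    convert e using 2
    all_goals
      funext X
      by_cases h1 : stopFun s (unitPath X) ∈ A <;>
        by_cases h2 : shiftFun s (unitPath X) ∈ D <;>
        simp [Set.indicator, h1, h2]
  refine ⟨hm2, fun E hE => ?_⟩
  have e := congrArg (fun ν => ν (glueFun s ⁻¹' E)) hν
  have hE' := measurable_glueFun s hE
  simp only [Measure.map_apply hmap hE'] at e
  rwa [withDensity_apply _ (hmap hE'), withDensity_apply _ (hmap hE'), ← Set.preimage_comp,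
    show glueFun s ∘ (fun X => (stopFun s (unitPath X), shiftFun s (unitPath X))) = unitPath from
      funext fun X => glueFun_stopFun_shiftFun s (unitPath X)] at e

end CondIndep

/-! ### Increments of the inverse clock along a subdivision -/

/-- The increment of the inverse clock over the `k`-th interval of length `h`. -/
def invClockIncr (h : ℝ≥0) (k : ℕ) (X : PathSp) : ℝ≥0 :=
  invClock X (((k + 1 : ℕ) : ℝ≥0) * h) - invClock X ((k : ℝ≥0) * h)

lemma measurable_invClockIncr (h : ℝ≥0) (k : ℕ) : Measurable (invClockIncr h k) :=
  (measurable_invClock _).sub (measurable_invClock _)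

lemma IsClocked.monotone_invClock {X : PathSp} (hX : IsClocked X) : Monotone (invClock X) := by
  obtain ⟨e, he⟩ := hX
  rw [funext (invClock_eq_symm he)]
  exact e.symm.monotone

lemma IsClocked.invClock_zero {X : PathSp} (hX : IsClocked X) : invClock X 0 = 0 := by
  obtain ⟨e, he⟩ := hX
  rw [invClock_eq_symm he]
  exact e.symm.map_bot

lemma IsClocked.sum_invClockIncr {X : PathSp} (hX : IsClocked X) (h : ℝ≥0) (n : ℕ) :
    ∑ k ∈ Finset.range n, invClockIncr h k X = invClock X (n * h) := by
  have hm : Monotone fun k : ℕ => invClock X ((k : ℝ≥0) * h) := fun i j hij =>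
    hX.monotone_invClock (mul_le_mul_left (Nat.cast_le.2 hij) h)
  have := Finset.sum_range_tsub hm n
  simpa [invClockIncr, hX.invClock_zero] using this

lemma IsShiftClocked.invClockIncr_eq {h : ℝ≥0} {k : ℕ} {X : PathSp}
    (hX : IsShiftClocked ((k : ℝ≥0) * h) X) :
    invClockIncr h k X = invClock (clockShift ((k : ℝ≥0) * h) X) h := by
  rw [invClockIncr, Nat.cast_succ, add_mul, one_mul, hX.invClock_add, add_tsub_cancel_left]

lemma isClockPastFun_prod_invClockIncr {f : ℝ≥0 → ℝ≥0∞} (hf : Measurable f) (h : ℝ≥0) (n : ℕ) :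
    IsClockPastFun ((n : ℝ≥0) * h) fun X => ∏ k ∈ Finset.range n, f (invClockIncr h k X) := by
  refine ⟨Finset.measurable_fun_prod _ fun k _ => hf.comp (measurable_invClockIncr h k),
    fun u X hu => Finset.prod_congr rfl fun k hk => ?_⟩
  have hk' := Finset.mem_range.1 hk
  have h1 : ((k + 1 : ℕ) : ℝ≥0) * h ≤ n * h := mul_le_mul_left (Nat.cast_le.2 hk') h
  have h2 : (k : ℝ≥0) * h ≤ n * h := mul_le_mul_left (Nat.cast_le.2 hk'.le) h
  rw [invClockIncr, invClock_stopPath h1 hu, invClock_stopPath h2 hu, invClockIncr]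

lemma IsClocked.eventually_invClockIncr_le {X : PathSp} (hX : IsClocked X) (t : ℝ≥0) {δ : ℝ≥0}
    (hδ : 0 < δ) :
    ∀ᶠ N : ℕ in atTop, ∀ k < N + 1, invClockIncr (t / ((N + 1 : ℕ) : ℝ≥0)) k X ≤ δ := by
  have huc := isCompact_Icc.uniformContinuousOn_of_continuous
    (s := Set.Icc 0 t) hX.continuous_invClock.continuousOn
  obtain ⟨η, hη, hη'⟩ := Metric.uniformContinuousOn_iff.1 huc δ hδ
  have hlim : Tendsto (fun N : ℕ => (t : ℝ) / ((N + 1 : ℕ) : ℝ)) atTop (𝓝 0) :=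
    (tendsto_const_div_atTop_nhds_zero_nat (t : ℝ)).comp (tendsto_add_atTop_nat 1)
  filter_upwards [hlim.eventually (gt_mem_nhds hη)] with N hN k hk
  have hpos : ((N + 1 : ℕ) : ℝ≥0) ≠ 0 := Nat.cast_ne_zero.2 (Nat.succ_ne_zero N)
  have hle : ∀ j : ℕ, j ≤ N + 1 → (j : ℝ≥0) * (t / ((N + 1 : ℕ) : ℝ≥0)) ∈ Set.Icc 0 t := by
    refine fun j hj => ⟨zero_le, ?_⟩
    calc (j : ℝ≥0) * (t / ((N + 1 : ℕ) : ℝ≥0)) ≤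
        ((N + 1 : ℕ) : ℝ≥0) * (t / ((N + 1 : ℕ) : ℝ≥0)) :=
          mul_le_mul_left (Nat.cast_le.2 hj) _
      _ = t := mul_div_cancel₀ t hpos
  have hd := hη' _ (hle (k + 1) hk) _ (hle k hk.le) (by
    rw [NNReal.dist_eq]
    push_cast
    rw [add_mul, add_sub_cancel_left, one_mul, abs_of_nonneg (by positivity)]
    push_cast at hN
    exact hN)
  rw [NNReal.dist_eq] at hd
  rw [invClockIncr, tsub_le_iff_left, ← NNReal.coe_le_coe, NNReal.coe_add]
  linarith [le_abs_self ((invClock X (((k + 1 : ℕ) : ℝ≥0) * (t / ((N + 1 : ℕ) : ℝ≥0))) : ℝ) -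
    invClock X ((k : ℝ≥0) * (t / ((N + 1 : ℕ) : ℝ≥0))))]

lemma IsCondLExp.congr_right {Ω W : Type*} [MeasurableSpace Ω] [MeasurableSpace W]
    {Q : Measure Ω} {U : Ω → W} {G : Ω → ℝ≥0∞} {h h' : W → ℝ≥0∞} (hh : IsCondLExp Q U G h)
    (hm : Measurable h') (he : ∀ᵐ X ∂Q, h (U X) = h' (U X)) : IsCondLExp Q U G h' :=
  ⟨hm, fun E hE => by
    rw [hh.setLIntegral E hE]; exact lintegral_congr_ae (ae_restrict_of_ae he)⟩

section Product

variable {P : ℂ → ProbabilityMeasure PathSp} {m : Measure ℂ}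

lemma isCondLExp_prod_invClockIncr (hPc : Continuous P) (hP : DefinesMTCBM P) [IsFiniteMeasure m]
    {f : ℝ≥0 → ℝ≥0∞} (hf : Measurable f) (hf1 : ∀ d, f d ≤ 1) (h : ℝ≥0)
    {a : ℕ → (ℝ≥0 → ℂ) → ℝ≥0∞}
    (ha : ∀ k, IsCondLExp (mixture P m) unitPath (fun X => f (invClockIncr h k X)) (a k))
    (n : ℕ) :
    IsCondLExp (mixture P m) unitPath (fun X => ∏ k ∈ Finset.range n, f (invClockIncr h k X))
      fun p => ∏ k ∈ Finset.range n, a k p := by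
  have := isFiniteMeasure_mixture (m := m) hPc
  induction n with
  | zero => simpa using IsCondLExp.const (mixture P m) unitPath 1
  | succ n ih =>
    have hfin : IsFiniteMeasure ((mixture P m).map fun X => unitPath X ((n : ℝ≥0) * h)) :=
      Measure.isFiniteMeasure_map _ _
    have hfin' := isFiniteMeasure_mixture
      (m := (mixture P m).map fun X => unitPath X ((n : ℝ≥0) * h)) hPc
    obtain ⟨b, hb⟩ := exists_isCondLExp
      (Q := mixture P ((mixture P m).map fun X => unitPath X ((n : ℝ≥0) * h)))
      (G := fun X => f (invClock X h)) measurable_unitPath (fun X => hf1 _)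
    have hH : Measurable fun X => f (invClock X h) := hf.comp (measurable_invClock h)
    have hincr : (fun X => f (invClock (clockShift ((n : ℝ≥0) * h) X) h)) =ᵐ[mixture P m]
        fun X => f (invClockIncr h n X) := by
      filter_upwards [ae_mixture_isShiftClocked hPc hP.2.2 ((n : ℝ≥0) * h)] with X hX
      rw [hX.invClockIncr_eq]
    have h1 : IsClockPastFun ((n : ℝ≥0) * h) fun _ : PathSp => (1 : ℝ≥0∞) :=
      ⟨measurable_const, fun _ _ _ => rfl⟩
    have e1 := (IsCondLExp.const (mixture P m) unitPath 1).mul_clockShift hPc hP h1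
      (fun _ => le_rfl) hH (fun X => hf1 _) hb
    simp only [one_mul] at e1
    have e2 := (e1.congr hincr).unique (ha n) measurable_unitPath
    have e3 := ih.mul_clockShift hPc hP (isClockPastFun_prod_invClockIncr hf h n)
      (fun X => Finset.prod_le_one' fun k _ => hf1 _) hH (fun X => hf1 _) hb
    refine (e3.congr ?_).congr_right
      (Finset.measurable_fun_prod _ fun k _ => (ha k).measurable) ?_
    · filter_upwards [hincr] with X hX
      rw [hX, Finset.prod_range_succ]
    · filter_upwards [e2] with X hX
      rw [hX, Finset.prod_range_succ]

end Product

/-! ### Estimates for truncated exponentials -/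

/-- The function `d ↦ exp (-d)` with extended nonnegative values. -/
def expNeg (d : ℝ≥0) : ℝ≥0∞ := ENNReal.ofReal (Real.exp (-d))

lemma measurable_expNeg : Measurable expNeg := by
  unfold expNeg; fun_prop

lemma expNeg_le_one (d : ℝ≥0) : expNeg d ≤ 1 := by
  rw [expNeg, ENNReal.ofReal_le_one, Real.exp_le_one_iff]
  simp

lemma expNeg_ne_zero (d : ℝ≥0) : expNeg d ≠ 0 := by
  simp [expNeg, Real.exp_pos]

lemma expNeg_anti {d d' : ℝ≥0} (h : d ≤ d') : expNeg d' ≤ expNeg d := by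
  refine ENNReal.ofReal_le_ofReal (Real.exp_le_exp.2 (neg_le_neg ?_))
  exact_mod_cast h

lemma prod_expNeg (s : Finset ℕ) (d : ℕ → ℝ≥0) :
    ∏ k ∈ s, expNeg (d k) = expNeg (∑ k ∈ s, d k) := by
  simp only [expNeg]
  rw [← ENNReal.ofReal_prod_of_nonneg fun _ _ => (Real.exp_pos _).le, ← Real.exp_sum]
  simp

lemma expNeg_sq_add_le {d δ : ℝ≥0} (h : d ≤ δ) :
    expNeg d ^ 2 + 1 + δ * expNeg d ≤ 2 * expNeg d + δ := by
  have h1 : Real.exp (-d) ≤ 1 := by simp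
  have h2 : 1 - (d : ℝ) ≤ Real.exp (-d) := Real.one_sub_le_exp_neg d
  have h3 : (d : ℝ) ≤ δ := by exact_mod_cast h
  have h0 := (Real.exp_pos (-d)).le
  rw [expNeg, ← ENNReal.ofReal_coe_nnreal (p := δ), ← ENNReal.ofReal_pow h0,
    ← ENNReal.ofReal_mul δ.coe_nonneg, ← ENNReal.ofReal_one,
    ← ENNReal.ofReal_add (by positivity) one_pos.le,
    ← ENNReal.ofReal_add (by positivity) (by positivity),
    show (2 : ℝ≥0∞) = ENNReal.ofReal 2 by simp, ← ENNReal.ofReal_mul two_pos.le,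
    ← ENNReal.ofReal_add (by positivity) δ.coe_nonneg]
  refine ENNReal.ofReal_le_ofReal ?_
  nlinarith

lemma prod_mul_prod_le {a b c : ℕ → ℝ≥0} {δ : ℝ≥0} (hca : ∀ k, c k ≤ a k) (ha : ∀ k, a k ≤ 1)
    (hb : ∀ k, b k + 1 + δ * a k ≤ 2 * a k + δ) (hb1 : ∀ k, b k ≤ 1) (n : ℕ) :
    (∏ k ∈ Finset.range n, c k) * ∏ k ∈ Finset.range n, b k ≤
      (∏ k ∈ Finset.range n, c k) * (∏ k ∈ Finset.range n, a k) ^ 2 + δ := by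
  have hca' : ∀ k, (c k : ℝ) ≤ a k := fun k => by exact_mod_cast hca k
  have ha' : ∀ k, (a k : ℝ) ≤ 1 := fun k => by exact_mod_cast ha k
  have hb' : ∀ k, (b k : ℝ) + 1 + δ * a k ≤ 2 * a k + δ := fun k => by exact_mod_cast hb k
  have hb1' : ∀ k, (b k : ℝ) ≤ 1 := fun k => by exact_mod_cast hb1 k
  have hδ := δ.coe_nonneg
  have e1 : ∀ n, (∏ k ∈ Finset.range n, (b k : ℝ)) ≤
      (∏ k ∈ Finset.range n, (a k : ℝ)) ^ 2 + δ * ∑ k ∈ Finset.range n, (1 - (c k : ℝ)) := by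
    intro n
    induction n with
    | zero => simp
    | succ n ih =>
      have hB0 : 0 ≤ ∏ k ∈ Finset.range n, (b k : ℝ) := Finset.prod_nonneg fun k _ => (b k).2
      have hB1 : ∏ k ∈ Finset.range n, (b k : ℝ) ≤ 1 :=
        Finset.prod_le_one (fun k _ => (b k).2) fun k _ => hb1' k
      have hS : 0 ≤ ∑ k ∈ Finset.range n, (1 - (c k : ℝ)) :=
        Finset.sum_nonneg fun k _ => sub_nonneg.2 ((hca' k).trans (ha' k))
      rw [Finset.prod_range_succ, Finset.prod_range_succ, Finset.sum_range_succ]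
      generalize ∏ k ∈ Finset.range n, (b k : ℝ) = B at *
      generalize ∏ k ∈ Finset.range n, (a k : ℝ) = A at *
      generalize ∑ k ∈ Finset.range n, (1 - (c k : ℝ)) = S at *
      have a0 : (0 : ℝ) ≤ a n := (a n).2
      have hbn : (b n : ℝ) ≤ (a n : ℝ) ^ 2 + δ * (1 - a n) := by
        nlinarith [hb' n, sq_nonneg (1 - (a n : ℝ))]
      have hd : 0 ≤ (δ : ℝ) * (1 - a n) := mul_nonneg hδ (sub_nonneg.2 (ha' n))
      have ha2 : (a n : ℝ) ^ 2 ≤ 1 := pow_le_one₀ a0 (ha' n)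
      calc B * b n ≤ B * ((a n : ℝ) ^ 2 + δ * (1 - a n)) := mul_le_mul_of_nonneg_left hbn hB0
        _ = (a n : ℝ) ^ 2 * B + B * (δ * (1 - a n)) := by ring
        _ ≤ (a n : ℝ) ^ 2 * (A ^ 2 + δ * S) + 1 * (δ * (1 - a n)) :=
          add_le_add (mul_le_mul_of_nonneg_left ih (sq_nonneg _))
            (mul_le_mul_of_nonneg_right hB1 hd)
        _ = (A * a n) ^ 2 + (a n : ℝ) ^ 2 * (δ * S) + δ * (1 - a n) := by ring
        _ ≤ (A * a n) ^ 2 + 1 * (δ * S) + δ * (1 - c n) := by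
          have := mul_le_mul_of_nonneg_right ha2 (mul_nonneg hδ hS)
          have := mul_le_mul_of_nonneg_left (sub_le_sub_left (hca' n) 1) hδ
          linarith
        _ = _ := by ring
  have e2 : ∀ n, (∏ k ∈ Finset.range n, (c k : ℝ)) * ∑ k ∈ Finset.range n, (1 - (c k : ℝ)) ≤
      1 - ∏ k ∈ Finset.range n, (c k : ℝ) := by
    intro n
    induction n with
    | zero => simp
    | succ n ih =>
      have hC0 : 0 ≤ ∏ k ∈ Finset.range n, (c k : ℝ) := Finset.prod_nonneg fun k _ => (c k).2
      have hS : 0 ≤ ∑ k ∈ Finset.range n, (1 - (c k : ℝ)) :=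
        Finset.sum_nonneg fun k _ => sub_nonneg.2 ((hca' k).trans (ha' k))
      rw [Finset.prod_range_succ, Finset.sum_range_succ]
      generalize ∏ k ∈ Finset.range n, (c k : ℝ) = C at *
      generalize ∑ k ∈ Finset.range n, (1 - (c k : ℝ)) = S at *
      have c0 : (0 : ℝ) ≤ c n := (c n).2
      have c1 : (c n : ℝ) ≤ 1 := (hca' n).trans (ha' n)
      have h1 : c n * (C * S) ≤ C * S := mul_le_of_le_one_left (mul_nonneg hC0 hS) c1
      have h2 : c n * (C * (1 - c n)) ≤ C * (1 - c n) :=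
        mul_le_of_le_one_left (mul_nonneg hC0 (sub_nonneg.2 c1)) c1
      nlinarith
  have hC0 : 0 ≤ ∏ k ∈ Finset.range n, (c k : ℝ) := Finset.prod_nonneg fun k _ => (c k).2
  rw [← NNReal.coe_le_coe]
  push_cast
  have h1 := mul_le_mul_of_nonneg_left (e1 n) hC0
  have h2 := mul_le_mul_of_nonneg_left (e2 n) hδ
  have h3 := mul_nonneg hδ hC0
  nlinarith

/-! ### The inverse clock is a function of the time-changed path -/

section Determinism

variable {P : ℂ → ProbabilityMeasure PathSp} {m : Measure ℂ}

lemma IsClocked.expNeg_invClock_eq_prod {X : PathSp} (hX : IsClocked X) (t : ℝ≥0) (N : ℕ) :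
    expNeg (invClock X t) =
      ∏ k ∈ Finset.range (N + 1), expNeg (invClockIncr (t / ((N + 1 : ℕ) : ℝ≥0)) k X) := by
  rw [prod_expNeg, hX.sum_invClockIncr,
    mul_div_cancel₀ t (Nat.cast_ne_zero.2 (Nat.succ_ne_zero N))]

lemma ENNReal.mul_sq_add_le {c x : ℝ≥0∞} (hcx : c ≤ x) (hx : x ≤ 1) :
    c * x ^ 2 + 2 * c ≤ c ^ 3 + 2 * x := by
  lift x to ℝ≥0 using ne_top_of_le_ne_top ENNReal.one_ne_top hx
  lift c to ℝ≥0 using ne_top_of_le_ne_top ENNReal.coe_ne_top hcx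
  norm_cast at hcx hx ⊢
  rw [← NNReal.coe_le_coe] at hcx hx ⊢
  push_cast at hcx hx ⊢
  have hc := c.coe_nonneg
  nlinarith [mul_nonneg (sub_nonneg.2 hcx) hc, mul_nonneg (sub_nonneg.2 hcx)
    (show 0 ≤ 2 - (c : ℝ) * (x + c) by nlinarith)]

lemma ENNReal.eq_of_mul_sq_add_eq {c y : ℝ≥0∞} (hc : c ≤ 1) (hc0 : c ≠ 0) (hy : y ≤ 1)
    (h : 2 * c ^ 2 * y = c * y ^ 2 + c ^ 3) : y = c := by
  lift y to ℝ≥0 using ne_top_of_le_ne_top ENNReal.one_ne_top hy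
  lift c to ℝ≥0 using ne_top_of_le_ne_top ENNReal.one_ne_top hc
  norm_cast at h hc0 ⊢
  rw [← NNReal.coe_inj] at h ⊢
  push_cast at h
  have h0 : (c : ℝ) ≠ 0 := by exact_mod_cast hc0
  have : (c : ℝ) * ((y : ℝ) - c) ^ 2 = 0 := by linear_combination -h
  exact sub_eq_zero.1 (pow_eq_zero_iff two_ne_zero |>.1 ((mul_eq_zero.1 this).resolve_left h0))

lemma ENNReal.two_mul_sq_mul_le {c y : ℝ≥0∞} (hc : c ≤ 1) (hy : y ≤ 1) :
    2 * c ^ 2 * y ≤ c * y ^ 2 + c ^ 3 := by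
  lift y to ℝ≥0 using ne_top_of_le_ne_top ENNReal.one_ne_top hy
  lift c to ℝ≥0 using ne_top_of_le_ne_top ENNReal.one_ne_top hc
  norm_cast
  rw [← NNReal.coe_le_coe]
  push_cast
  nlinarith [mul_nonneg c.coe_nonneg (sq_nonneg ((y : ℝ) - c))]

lemma lintegral_condLExp_prod_expNeg_le {α W : Type*} [MeasurableSpace α] [MeasurableSpace W]
    {Q : Measure α} [IsFiniteMeasure Q] {U : α → W} (hU : Measurable U) {D : ℕ → α → ℝ≥0}
    (hDm : ∀ k, Measurable (D k))
    (hprod : ∀ f : ℝ≥0 → ℝ≥0∞, Measurable f → (∀ d, f d ≤ 1) → ∀ a : ℕ → W → ℝ≥0∞,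
      (∀ k, IsCondLExp Q U (fun X => f (D k X)) (a k)) → ∀ n, IsCondLExp Q U
        (fun X => ∏ k ∈ Finset.range n, f (D k X)) fun p => ∏ k ∈ Finset.range n, a k p)
    {n : ℕ} {y : α → ℝ≥0∞} (hyD : ∀ᵐ X ∂Q, y X = ∏ k ∈ Finset.range n, expNeg (D k X))
    {c : W → ℝ≥0∞} (hc : IsCondLExp Q U y c) (δ : ℝ≥0) :
    ∫⁻ X, c (U X) * y X ^ 2 ∂Q + 2 * ∫⁻ X, y X ∂Q ≤
      ∫⁻ X, c (U X) ^ 3 ∂Q +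
        2 * ∫⁻ X, ∏ k ∈ Finset.range n, expNeg (min (D k X) δ) ∂Q + δ * Q Set.univ := by
  obtain ⟨g, hg⟩ : ∃ g : ℝ≥0 → ℝ≥0∞, g = fun d => expNeg (min d δ) := ⟨_, rfl⟩
  have hgm : Measurable g := by
    rw [hg]; exact measurable_expNeg.comp (measurable_id.min measurable_const)
  have hg1 : ∀ d, g d ≤ 1 := fun d => by rw [hg]; exact expNeg_le_one _
  have hge : ∀ d, expNeg d ≤ g d := fun d => by rw [hg]; exact expNeg_anti (min_le_left _ _)
  have hg2 : ∀ d, g d ^ 2 + 1 + δ * g d ≤ 2 * g d + δ := fun d => by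
    rw [hg]; exact expNeg_sq_add_le (min_le_right _ _)
  have hg2m : Measurable fun d => g d ^ 2 := hgm.pow_const 2
  have hg21 : ∀ d, g d ^ 2 ≤ 1 := fun d => pow_le_one' (hg1 d) 2
  have hDg : ∀ k, Measurable fun X => g (D k X) := fun k => hgm.comp (hDm k)
  choose a ha using fun k => exists_isCondLExp (Q := Q) (G := fun X => g (D k X)) hU
    fun X => hg1 _
  choose b hb using fun k => exists_isCondLExp (Q := Q) (G := fun X => g (D k X) ^ 2) hU
    fun X => hg21 _
  choose e he using fun k => exists_isCondLExp (Q := Q) (G := fun X => expNeg (D k X)) hU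
    fun X => expNeg_le_one _
  have pa := hprod g hgm hg1 a ha n
  have pb := hprod (fun d => g d ^ 2) hg2m hg21 b hb n
  have pe := hprod expNeg measurable_expNeg expNeg_le_one e he n
  have hce := hc.unique (pe.congr (hyD.mono fun X hX => hX.symm)) hU
  have hea : ∀ᵐ X ∂Q, ∀ k, e k (U X) ≤ a k (U X) :=
    ae_all_iff.2 fun k => (he k).mono (ha k) hU
      (Eventually.of_forall fun X => hge _)
  have ha1 : ∀ᵐ X ∂Q, ∀ k, a k (U X) ≤ 1 :=
    ae_all_iff.2 fun k => (ha k).mono (IsCondLExp.const Q U 1) hU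
      (Eventually.of_forall fun X => hg1 _)
  have hb1 : ∀ᵐ X ∂Q, ∀ k, b k (U X) ≤ 1 :=
    ae_all_iff.2 fun k => (hb k).mono (IsCondLExp.const Q U 1) hU
      (Eventually.of_forall fun X => hg21 _)
  have hab : ∀ᵐ X ∂Q, ∀ k, b k (U X) + 1 + δ * a k (U X) ≤
      2 * a k (U X) + δ :=
    ae_all_iff.2 fun k =>
      (((hb k).add (IsCondLExp.const Q U 1) hU ((hDg k).pow_const 2)).add
        ((ha k).const_mul hU (hDg k) δ) hU (((hDg k).pow_const 2).add_const 1)).mono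
      (((ha k).const_mul hU (hDg k) 2).add (IsCondLExp.const Q U δ) hU
        ((hDg k).const_mul 2)) hU
      (Eventually.of_forall fun X => hg2 _)
  have hcm : Measurable fun X => c (U X) := hc.measurable_comp hU
  have hpb : ∀ᵐ X ∂Q, c (U X) * ∏ k ∈ Finset.range n, b k (U X) ≤
      c (U X) * (∏ k ∈ Finset.range n, a k (U X)) ^ 2 + δ := by
    filter_upwards [hce, hea, ha1, hb1, hab] with X h0 h1 h2 h3 h4
    rw [h0]
    have ta : ∀ k, a k (U X) ≠ ∞ := fun k =>
      ne_top_of_le_ne_top ENNReal.one_ne_top (h2 k)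
    have tb : ∀ k, b k (U X) ≠ ∞ := fun k =>
      ne_top_of_le_ne_top ENNReal.one_ne_top (h3 k)
    have te : ∀ k, e k (U X) ≠ ∞ := fun k => ne_top_of_le_ne_top (ta k) (h1 k)
    choose a' ha' using fun k => (⟨_, ENNReal.coe_toNNReal (ta k)⟩ :
      ∃ x : ℝ≥0, (x : ℝ≥0∞) = a k (U X))
    choose b' hb' using fun k => (⟨_, ENNReal.coe_toNNReal (tb k)⟩ :
      ∃ x : ℝ≥0, (x : ℝ≥0∞) = b k (U X))
    choose e' he' using fun k => (⟨_, ENNReal.coe_toNNReal (te k)⟩ :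
      ∃ x : ℝ≥0, (x : ℝ≥0∞) = e k (U X))
    simp only [← ha', ← hb', ← he'] at h1 h2 h3 h4 ⊢
    norm_cast at h1 h2 h3 h4 ⊢
    exact prod_mul_prod_le h1 h2 h4 h3 n
  have hx : ∀ᵐ X ∂Q, c (U X) * (∏ k ∈ Finset.range n, a k (U X)) ^ 2 +
      2 * c (U X) ≤ c (U X) ^ 3 +
        2 * ∏ k ∈ Finset.range n, a k (U X) := by
    filter_upwards [hce, hea, ha1] with X h0 h1 h2
    refine ENNReal.mul_sq_add_le ?_ (Finset.prod_le_one' fun k _ => h2 k)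
    rw [h0]
    exact Finset.prod_le_prod' fun k _ => h1 k
  have hy : ∀ᵐ X ∂Q, y X ^ 2 ≤
      ∏ k ∈ Finset.range n, g (D k X) ^ 2 := by
    filter_upwards [hyD] with X hX
    rw [hX, Finset.prod_pow]
    exact pow_le_pow_left' (Finset.prod_le_prod' fun k _ => hge _) 2
  calc _ ≤ ∫⁻ X, c (U X) * ∏ k ∈ Finset.range n, g (D k X) ^ 2 ∂Q +
        2 * ∫⁻ X, y X ∂Q := by
        gcongr ?_ + _
        exact lintegral_mono_ae (hy.mono fun X h => mul_le_mul_right h _)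
    _ = ∫⁻ X, c (U X) * ∏ k ∈ Finset.range n, b k (U X) ∂Q +
        2 * ∫⁻ X, y X ∂Q := by
        rw [pb.lintegral_mul hU
          (Finset.measurable_fun_prod _ fun k _ => (hDg k).pow_const 2) hc.measurable]
    _ ≤ ∫⁻ X, (c (U X) * (∏ k ∈ Finset.range n, a k (U X)) ^ 2 + δ) ∂Q +
        2 * ∫⁻ X, y X ∂Q := by
        gcongr ?_ + _
        exact lintegral_mono_ae hpb
    _ = ∫⁻ X, (c (U X) * (∏ k ∈ Finset.range n, a k (U X)) ^ 2 +
        2 * c (U X)) ∂Q + δ * Q Set.univ := by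
        rw [lintegral_add_right _ measurable_const, lintegral_add_right _ (hcm.const_mul 2),
          lintegral_const_mul 2 hcm, hc.lintegral, lintegral_const]
        ring
    _ ≤ ∫⁻ X, (c (U X) ^ 3 +
        2 * ∏ k ∈ Finset.range n, a k (U X)) ∂Q + δ * Q Set.univ := by
        gcongr ?_ + _
        exact lintegral_mono_ae hx
    _ = _ := by
        rw [lintegral_add_left (hcm.pow_const 3),
          lintegral_const_mul 2 (pa.measurable_comp hU), ← pa.lintegral, hg]

lemma lintegral_condLExp_expNeg_le (hPc : Continuous P) (hP : DefinesMTCBM P) [IsFiniteMeasure m]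
    (t : ℝ≥0) {c : (ℝ≥0 → ℂ) → ℝ≥0∞}
    (hc : IsCondLExp (mixture P m) unitPath (fun X => expNeg (invClock X t)) c)
    (δ : ℝ≥0) (N : ℕ) :
    ∫⁻ X, c (unitPath X) * expNeg (invClock X t) ^ 2 ∂mixture P m +
        2 * ∫⁻ X, expNeg (invClock X t) ∂mixture P m ≤
      ∫⁻ X, c (unitPath X) ^ 3 ∂mixture P m +
        2 * ∫⁻ X, ∏ k ∈ Finset.range (N + 1),
          expNeg (min (invClockIncr (t / ((N + 1 : ℕ) : ℝ≥0)) k X) δ) ∂mixture P m +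
        δ * mixture P m Set.univ := by
  have hfin := isFiniteMeasure_mixture (m := m) hPc
  exact lintegral_condLExp_prod_expNeg_le measurable_unitPath (fun k => measurable_invClockIncr _ k)
    (fun f hf hf1 a ha n => isCondLExp_prod_invClockIncr hPc hP hf hf1 _ ha n)
    ((ae_mixture_isShiftClocked hPc hP.2.2 0).mono fun X hX =>
      hX.1.expNeg_invClock_eq_prod t N) hc δ

set_option maxHeartbeats 1000000 in
lemma exists_expNeg_invClock_eq (hPc : Continuous P) (hP : DefinesMTCBM P) [IsFiniteMeasure m]
    (t : ℝ≥0) : ∃ c : (ℝ≥0 → ℂ) → ℝ≥0∞, Measurable c ∧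
      ∀ᵐ X ∂mixture P m, expNeg (invClock X t) = c (unitPath X) := by
  have hfin := isFiniteMeasure_mixture (m := m) hPc
  have hU := measurable_unitPath
  have hym : Measurable fun X => expNeg (invClock X t) :=
    measurable_expNeg.comp (measurable_invClock t)
  obtain ⟨c, hc⟩ := exists_isCondLExp (Q := mixture P m)
    (G := fun X => expNeg (invClock X t)) hU fun X => expNeg_le_one _
  have hcm : Measurable fun X => c (unitPath X) := hc.measurable_comp hU
  set Q := mixture P m
  have hclk : ∀ᵐ X ∂Q, IsClocked X :=
    (ae_mixture_isShiftClocked hPc hP.2.2 0).mono fun X hX => hX.1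
  have hy_fin : 2 * ∫⁻ X, expNeg (invClock X t) ∂Q ≠ ∞ := by
    refine ENNReal.mul_ne_top (by simp) (ne_top_of_le_ne_top (measure_ne_top Q Set.univ) ?_)
    calc _ ≤ ∫⁻ _, 1 ∂Q := lintegral_mono fun X => expNeg_le_one _
      _ = _ := by simp
  have step : ∀ δ : ℝ≥0, 0 < δ → ∫⁻ X, c (unitPath X) * expNeg (invClock X t) ^ 2 ∂Q ≤
      ∫⁻ X, c (unitPath X) ^ 3 ∂Q + δ * Q Set.univ := by
    intro δ hδ
    have hlim : Tendsto (fun N : ℕ => ∫⁻ X, ∏ k ∈ Finset.range (N + 1),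
        expNeg (min (invClockIncr (t / ((N + 1 : ℕ) : ℝ≥0)) k X) δ) ∂Q) atTop
        (𝓝 (∫⁻ X, expNeg (invClock X t) ∂Q)) := by
      refine tendsto_lintegral_of_dominated_convergence (fun _ => 1) (fun N => ?_)
        (fun N => Eventually.of_forall fun X => Finset.prod_le_one' fun k _ => expNeg_le_one _)
        (by simp) ?_
      · exact Finset.measurable_fun_prod _ fun k _ => measurable_expNeg.comp
          ((measurable_invClockIncr _ k).min measurable_const)
      · filter_upwards [hclk] with X hX
        refine tendsto_const_nhds.congr' ?_
        filter_upwards [hX.eventually_invClockIncr_le t hδ] with N hN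
        rw [hX.expNeg_invClock_eq_prod t N]
        refine Finset.prod_congr rfl fun k hk => ?_
        rw [min_eq_left (hN k (Finset.mem_range.1 hk))]
    have h := ge_of_tendsto' (((ENNReal.Tendsto.const_mul hlim (Or.inr (by simp))).const_add
      (∫⁻ X, c (unitPath X) ^ 3 ∂Q)).add_const (δ * Q Set.univ))
      fun N => lintegral_condLExp_expNeg_le hPc hP t hc δ N
    rw [add_right_comm] at h
    exact (ENNReal.add_le_add_iff_right hy_fin).1 h
  have hle : ∫⁻ X, c (unitPath X) * expNeg (invClock X t) ^ 2 ∂Q ≤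
      ∫⁻ X, c (unitPath X) ^ 3 ∂Q := by
    have hlim : Tendsto (fun n : ℕ => ∫⁻ X, c (unitPath X) ^ 3 ∂Q +
        (((n : ℝ≥0) + 1)⁻¹ : ℝ≥0) * Q Set.univ) atTop
        (𝓝 (∫⁻ X, c (unitPath X) ^ 3 ∂Q + (0 : ℝ≥0) * Q Set.univ)) := by
      refine (ENNReal.Tendsto.mul_const ?_ (Or.inr (measure_ne_top _ _))).const_add _
      refine ENNReal.tendsto_coe.2 ?_
      have := tendsto_one_div_add_atTop_nhds_zero_nat (𝕜 := ℝ≥0)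
      simpa using this
    have h := ge_of_tendsto' hlim fun n => step _ (by positivity)
    simpa using h
  have hc1 : ∀ᵐ X ∂Q, c (unitPath X) ≤ 1 :=
    hc.mono (IsCondLExp.const Q unitPath 1) hU (Eventually.of_forall fun X => expNeg_le_one _)
  have hc0 : ∀ᵐ X ∂Q, c (unitPath X) ≠ 0 := by
    have hE : MeasurableSet (c ⁻¹' {0}) := hc.measurable (measurableSet_singleton 0)
    have h := hc.setLIntegral _ hE
    have h0 : ∫⁻ X in unitPath ⁻¹' (c ⁻¹' {0}), c (unitPath X) ∂Q = 0 := by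
      rw [setLIntegral_eq_zero_iff (hU hE) hcm]
      exact Eventually.of_forall fun X hX => hX
    rw [h0, setLIntegral_eq_zero_iff (hU hE) hym] at h
    filter_upwards [h] with X hX hX0
    exact expNeg_ne_zero _ (hX hX0)
  have hc3 : ∫⁻ X, c (unitPath X) ^ 3 ∂Q ≠ ∞ := by
    refine ne_top_of_le_ne_top (measure_ne_top Q Set.univ) ?_
    calc _ ≤ ∫⁻ _, 1 ∂Q := lintegral_mono_ae (hc1.mono fun X h => pow_le_one' h 3)
      _ = _ := by simp
  have e1 : ∫⁻ X, 2 * c (unitPath X) ^ 2 * expNeg (invClock X t) ∂Q =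
      2 * ∫⁻ X, c (unitPath X) ^ 3 ∂Q := by
    rw [hc.lintegral_mul hU hym (k := fun p => 2 * c p ^ 2)
      ((hc.measurable.pow_const 2).const_mul 2), ← lintegral_const_mul 2 (hcm.pow_const 3)]
    exact lintegral_congr fun X => by ring
  have heq := ae_eq_of_ae_le_of_lintegral_le (μ := Q)
    (f := fun X => 2 * c (unitPath X) ^ 2 * expNeg (invClock X t))
    (g := fun X => c (unitPath X) * expNeg (invClock X t) ^ 2 + c (unitPath X) ^ 3)
    (hc1.mono fun X h => ENNReal.two_mul_sq_mul_le h (expNeg_le_one _))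
    (by rw [e1]; exact ENNReal.mul_ne_top (by simp) hc3)
    ((hcm.mul (hym.pow_const 2)).add (hcm.pow_const 3)).aemeasurable
    (by
      rw [e1, lintegral_add_right _ (hcm.pow_const 3), two_mul]
      gcongr)
  refine ⟨c, hc.measurable, ?_⟩
  filter_upwards [heq, hc1, hc0] with X h1 h2 h3
  exact ENNReal.eq_of_mul_sq_add_eq h2 h3 (expNeg_le_one _) h1

lemma exists_invClock_eq (hPc : Continuous P) (hP : DefinesMTCBM P) [IsFiniteMeasure m]
    (t : ℝ≥0) : ∃ φ : (ℝ≥0 → ℂ) → ℝ≥0, Measurable φ ∧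
      ∀ᵐ X ∂mixture P m, invClock X t = φ (unitPath X) := by
  obtain ⟨c, hcm, hc⟩ := exists_expNeg_invClock_eq (m := m) hPc hP t
  refine ⟨fun p => Real.toNNReal (-Real.log (c p).toReal),
    (Real.measurable_log.comp hcm.ennreal_toReal).neg.real_toNNReal, ?_⟩
  filter_upwards [hc] with X hX
  rw [← hX, expNeg, ENNReal.toReal_ofReal (Real.exp_pos _).le, Real.log_exp, neg_neg,
    Real.toNNReal_coe]

end Determinism

/-! ### Continuous extension from the rationals -/

section RightExtension

/-- The right-continuous extension to `[0, ∞)` of a function on the nonnegative rationals. -/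
def rightExt (f : ℚ≥0 → ℝ≥0) (t : ℝ≥0) : ℝ≥0 := ⨅ q : {q : ℚ≥0 // t < (q : ℝ≥0)}, f q

/-- A monotone function on the nonnegative rationals with dense range. -/
def IsDenseMono (f : ℚ≥0 → ℝ≥0) : Prop :=
  (∀ p q : ℚ≥0, p < q → f p ≤ f q) ∧
    ∀ p q : ℚ≥0, p < q → ∃ r : ℚ≥0, (p : ℝ≥0) < f r ∧ f r < (q : ℝ≥0)

instance (t : ℝ≥0) : Nonempty {q : ℚ≥0 // t < (q : ℝ≥0)} :=
  let ⟨q, h, _⟩ := exists_nnrat_between (lt_add_one t)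
  ⟨⟨q, h⟩⟩

lemma rightExt_le (f : ℚ≥0 → ℝ≥0) {t : ℝ≥0} {q : ℚ≥0} (h : t < q) : rightExt f t ≤ f q :=
  ciInf_le (OrderBot.bddBelow _) (⟨q, h⟩ : {q : ℚ≥0 // t < (q : ℝ≥0)})

lemma monotone_rightExt (f : ℚ≥0 → ℝ≥0) : Monotone (rightExt f) := fun _ _ h =>
  le_ciInf fun q => rightExt_le f (h.trans_lt q.2)

lemma IsDenseMono.le_rightExt {f : ℚ≥0 → ℝ≥0} (hf : IsDenseMono f) (q : ℚ≥0) :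
    f q ≤ rightExt f q :=
  le_ciInf fun r => hf.1 q r (by exact_mod_cast r.2)

lemma IsDenseMono.continuous_rightExt {f : ℚ≥0 → ℝ≥0} (hf : IsDenseMono f) :
    Continuous (rightExt f) := by
  refine (monotone_rightExt f).continuous_of_denseRange (dense_of_exists_between fun a b hab => ?_)
  obtain ⟨p, hap, hpb⟩ := exists_nnrat_between hab
  obtain ⟨q, hpq, hqb⟩ := exists_nnrat_between hpb
  obtain ⟨o, hao, hop⟩ := exists_nnrat_between hap
  obtain ⟨r, hr1, hr2⟩ := hf.2 o p (by exact_mod_cast hop)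
  obtain ⟨r', hr1', hr2'⟩ := hf.2 p q (by exact_mod_cast hpq)
  have hrr : r < r' := by
    rcases lt_trichotomy r r' with h | h | h
    · exact h
    · rw [h] at hr2
      exact absurd (hr1'.trans hr2) (lt_irrefl _)
    · exact absurd ((hr2.trans hr1').trans_le (hf.1 _ _ h)) (lt_irrefl _)
  exact ⟨rightExt f r, ⟨r, rfl⟩, (hao.trans hr1).trans_le (hf.le_rightExt r),
    (rightExt_le f (by exact_mod_cast hrr)).trans_lt (hr2'.trans hqb)⟩

lemma isDenseMono_orderIso (e : ℝ≥0 ≃o ℝ≥0) : IsDenseMono fun q => e q := by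
  refine ⟨fun p q h => e.monotone (by exact_mod_cast h.le), fun p q h => ?_⟩
  have h' : e.symm p < e.symm q := e.symm.strictMono (by exact_mod_cast h)
  obtain ⟨r, h1, h2⟩ := exists_nnrat_between h'
  exact ⟨r, e.symm_apply_lt.1 h1, e.lt_symm_apply.1 h2⟩

lemma rightExt_orderIso (e : ℝ≥0 ≃o ℝ≥0) (t : ℝ≥0) : rightExt (fun q => e q) t = e t := by
  refine le_antisymm (le_of_forall_gt fun c hc => ?_) (le_ciInf fun q => e.monotone q.2.le)
  obtain ⟨q, h1, h2⟩ := exists_nnrat_between (e.lt_symm_apply.2 hc)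
  exact (rightExt_le _ h1).trans_lt (e.lt_symm_apply.1 h2)

lemma measurable_rightExt (t : ℝ≥0) : Measurable fun f => rightExt f t :=
  Measurable.iInf fun q => measurable_pi_apply (q : ℚ≥0)

lemma measurableSet_isDenseMono : MeasurableSet {f | IsDenseMono f} := by
  have hm : ∀ q : ℚ≥0, Measurable fun f : ℚ≥0 → ℝ≥0 => f q := fun q => measurable_pi_apply q
  have hset : {f : ℚ≥0 → ℝ≥0 | IsDenseMono f} =
      (⋂ (p : ℚ≥0) (q : ℚ≥0) (_ : p < q), {f | f p ≤ f q}) ∩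
        ⋂ (p : ℚ≥0) (q : ℚ≥0) (_ : p < q), ⋃ r : ℚ≥0,
          {f | (p : ℝ≥0) < f r} ∩ {f | f r < (q : ℝ≥0)} := by
    ext f
    simp [IsDenseMono]
  rw [hset]
  refine MeasurableSet.inter ?_ ?_
  · exact MeasurableSet.iInter fun p => MeasurableSet.iInter fun q => MeasurableSet.iInter fun _ =>
      measurableSet_le (hm p) (hm q)
  · exact MeasurableSet.iInter fun p => MeasurableSet.iInter fun q => MeasurableSet.iInter fun _ =>
      MeasurableSet.iUnion fun r => (measurableSet_lt measurable_const (hm r)).inter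
        (measurableSet_lt (hm r) measurable_const)

open Classical in
/-- The extension of `f` to a continuous nondecreasing function on `[0, ∞)`, if `f` is monotone
with dense range, and the zero function otherwise. -/
def contExt (f : ℚ≥0 → ℝ≥0) : ℝ≥0 → ℝ≥0 := if IsDenseMono f then rightExt f else 0

lemma measurable_contExt : Measurable contExt := by
  classical
  exact Measurable.ite measurableSet_isDenseMono (measurable_pi_lambda _ measurable_rightExt)
    measurable_const

lemma continuous_contExt (f : ℚ≥0 → ℝ≥0) : Continuous (contExt f) := by
  rw [contExt]
  split_ifs with h
  exacts [h.continuous_rightExt, continuous_zero]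

lemma monotone_contExt (f : ℚ≥0 → ℝ≥0) : Monotone (contExt f) := by
  rw [contExt]
  split_ifs
  exacts [monotone_rightExt f, monotone_const]

lemma contExt_orderIso (e : ℝ≥0 ≃o ℝ≥0) : contExt (fun q => e q) = e := by
  rw [contExt, if_pos (isDenseMono_orderIso e)]
  exact funext (rightExt_orderIso e)

lemma IsClocked.contExt_invClock {X : PathSp} (hX : IsClocked X) :
    contExt (fun q => invClock X q) = invClock X := by
  obtain ⟨e, he⟩ := hX
  rw [funext (invClock_eq_symm he)]
  exact contExt_orderIso e.symm

end RightExtension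

/-! ### Absolute continuity -/

section AbsolutelyContinuous

variable {P : ℂ → ProbabilityMeasure PathSp} {m m' : Measure ℂ}

lemma planarGaussian_absolutelyContinuous {v : ℝ≥0} (hv : v ≠ 0) :
    planarGaussian v ≪ volume := by
  have h := ((gaussianReal_absolutelyContinuous 0 hv).prod
    (gaussianReal_absolutelyContinuous 0 hv)).map Complex.measurableEquivRealProd.symm.measurable
  have h' := Complex.volume_preserving_equiv_real_prod.symm.map_eq
  rw [Measure.volume_eq_prod] at h'
  rw [h'] at h
  exact h

lemma IsPlanarBM.map_absolutelyContinuous {Ω : Type*} [MeasurableSpace Ω] {μ : Measure Ω}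
    [IsProbabilityMeasure μ] {B : ℝ≥0 → Ω → ℂ} {z : ℂ} (hB : IsPlanarBM μ B z)
    (hz : Measure.dirac z ≪ m) (hm : volume ≪ m) (t : ℝ≥0) : μ.map (B t) ≪ m := by
  rcases eq_or_ne t 0 with rfl | ht
  · have : μ.map (B 0) = Measure.dirac z := by
      rw [Measure.map_congr hB.start, Measure.map_const]
      simp
    rwa [this]
  · have hae : B t =ᵐ[μ] (fun w => z + w) ∘ fun ω => B t ω - B 0 ω := by
      filter_upwards [hB.start] with ω hω
      simp [hω]
    have hadd : Measurable fun w : ℂ => z + w := measurable_const_add z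
    have hsub : Measurable fun ω => B t ω - B 0 ω := (hB.meas t).sub (hB.meas 0)
    rw [Measure.map_congr hae, ← Measure.map_map hadd hsub,
      hB.incr 0 t zero_le, tsub_zero]
    have h := (planarGaussian_absolutelyContinuous ht).map hadd
    rw [map_add_left_eq_self (volume : Measure ℂ) z] at h
    exact h.trans hm

lemma mixture_dirac (hPc : Continuous P) (z : ℂ) :
    mixture P (Measure.dirac z) = (P z : Measure PathSp) :=
  Measure.dirac_bind (measurable_of_continuous_probabilityMeasure hPc) z

lemma mixture_absolutelyContinuous (hPc : Continuous P) (h : m ≪ m') :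
    mixture P m ≪ mixture P m' := by
  refine Measure.AbsolutelyContinuous.mk fun S hS h0 => ?_
  have hm : Measurable fun w => (P w : Measure PathSp) S :=
    (Measure.measurable_coe hS).comp (measurable_of_continuous_probabilityMeasure hPc)
  rw [mixture_apply hPc hS, lintegral_eq_zero_iff hm] at h0 ⊢
  exact h.ae_le h0

end AbsolutelyContinuous

theorem stmt16 (P : ℂ → ProbabilityMeasure PathSp) (hPc : Continuous P)
    (hP : DefinesMTCBM P) (z : ℂ)
    (Ω : Type) [MeasurableSpace Ω] (μ : Measure Ω) [IsProbabilityMeasure μ]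
    (B : ℝ≥0 → Ω → ℂ) (τ : ℝ≥0 → Ω → ℝ≥0) (F Gp : Ω → PathSp)
    (hB : IsPlanarBM μ B z)
    (hτ : ∀ᵐ ω ∂μ, τ 0 ω = 0 ∧ StrictMono (fun u => τ u ω) ∧
      Continuous (fun u => τ u ω) ∧ Tendsto (fun u => τ u ω) atTop atTop)
    -- `F` is the random path `u ↦ B_{τ_u}`, which has law `P_z`
    (hF : Measurable F) (hFB : ∀ᵐ ω ∂μ, ∀ u : ℝ≥0, F ω u = B (τ u ω) ω)
    (hFlaw : μ.map F = (P z : Measure PathSp))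
    -- `Gp` is the random path `t ↦ B_t` viewed as an element of `C([0,∞), ℂ)`
    (hGp : Measurable Gp) (hGpB : ∀ᵐ ω ∂μ, ∀ s : ℝ≥0, Gp ω s = B s ω) :
    -- `A_t := inf{u ≥ 0 : τ_u = t}`
    let A : ℝ≥0 → Ω → ℝ≥0 := fun t ω => sInf {u : ℝ≥0 | τ u ω = t}
    ∃ Φ : PathSp → ℝ≥0 → ℝ≥0,
      Measurable Φ ∧ (∀ p : PathSp, Continuous (Φ p) ∧ Monotone (Φ p)) ∧
      (∀ᵐ ω ∂μ, ∀ t : ℝ≥0, A t ω = Φ (Gp ω) t) ∧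
      (∀ s t : ℝ≥0, ∀ᵐ ω ∂μ, A (t + s) ω = A t ω + Φ (pathShift t (Gp ω)) s) := by
  intro A
  have hT := hP.2.2
  have hA : ∀ᵐ ω ∂μ, IsClocked (F ω) ∧ (∀ t, A t ω = invClock (F ω) t) ∧
      unitPath (F ω) = Gp ω := by
    filter_upwards [ae_exists_orderIso hτ hFB hGpB, ae_clock_of_isPlanarBM hB hGp hGpB]
      with ω ⟨e, he, hFe⟩ hclk
    have hFclk := clock_eq_of_timeChange hFe hclk
    refine ⟨⟨e, hFclk⟩, fun t => ?_, funext fun r => unitPath_eq_of_timeChange hFe hclk r⟩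
    have hset : {u : ℝ≥0 | τ u ω = t} = {e.symm t} := by
      ext u
      simp only [Set.mem_ofPred_eq, Set.mem_singleton_iff, he]
      exact e.toEquiv.eq_symm_apply.symm
    change sInf {u : ℝ≥0 | τ u ω = t} = _
    rw [hset, csInf_singleton, invClock_eq_symm hFclk]
  obtain ⟨ν, hνfin, hν, -⟩ := exists_isFiniteMeasure_absolutelyContinuous (volume : Measure ℂ)
  let m : Measure ℂ := Measure.dirac z + ν
  have hz : Measure.dirac z ≪ m := Measure.AbsolutelyContinuous.rfl.add_right ν
  have hm : volume ≪ m := by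
    have h : ν ≪ ν + Measure.dirac z := Measure.AbsolutelyContinuous.rfl.add_right _
    exact hν.trans (h.trans (by rw [add_comm]))
  choose φ hφm hφ using fun q : ℚ≥0 => exists_invClock_eq (m := m) hPc hP (q : ℝ≥0)
  have hcoe : Measurable fun p : PathSp => (p : ℝ≥0 → ℂ) :=
    measurable_pi_lambda _ measurable_eval_path
  let Φ : PathSp → ℝ≥0 → ℝ≥0 := fun p => contExt fun q => φ q p
  have hΦ : ∀ (X p : PathSp), IsClocked X → (∀ q : ℚ≥0, invClock X q = φ q (unitPath X)) →
      unitPath X = p → Φ p = invClock X := fun X p hX h hp => by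
    rw [← hX.contExt_invClock]
    simp only [Φ, h, hp]
  have hdirac : mixture P (Measure.dirac z) = (P z : Measure PathSp) := mixture_dirac hPc z
  refine ⟨Φ, measurable_contExt.comp (measurable_pi_lambda _ fun q => (hφm q).comp hcoe),
    fun p => ⟨continuous_contExt _, monotone_contExt _⟩, ?_, fun s t => ?_⟩
  · have h : ∀ᵐ X ∂μ.map F, ∀ q : ℚ≥0, invClock X q = φ q (unitPath X) := by
      rw [hFlaw, ← hdirac]
      exact (mixture_absolutelyContinuous hPc hz).ae_le (ae_all_iff.2 hφ)
    filter_upwards [hA, ae_of_ae_map hF.aemeasurable h] with ω ⟨h1, h2, h3⟩ h4 r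
    rw [h2, hΦ _ _ h1 h4 h3]
  · have hlaw : (mixture P (Measure.dirac z)).map (fun X => unitPath X t) = μ.map (B t) := by
      rw [hdirac, ← hFlaw, Measure.map_map (measurable_unitPath_apply t) hF]
      refine Measure.map_congr ?_
      filter_upwards [hA, hGpB] with ω ⟨_, _, h3⟩ h4
      rw [← h4, ← h3]
      rfl
    have h : ∀ᵐ X ∂(μ.map F).map (clockShift t),
        ∀ q : ℚ≥0, invClock X q = φ q (unitPath X) := by
      rw [hFlaw, ← hdirac, map_clockShift_mixture hPc hP.2.1 hT t, hlaw]
      exact (mixture_absolutelyContinuous hPc (hB.map_absolutelyContinuous hz hm t)).ae_le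
        (ae_all_iff.2 hφ)
    have hshift : ∀ᵐ X ∂μ.map F, IsShiftClocked t X := by
      rw [hFlaw]
      exact ae_isShiftClocked hT z t
    filter_upwards [hA, ae_of_ae_map hF.aemeasurable hshift, ae_of_ae_map hF.aemeasurable
      (ae_of_ae_map (measurable_clockShift t).aemeasurable h)] with ω ⟨_, h2, h3⟩ h4 h5
    have hu : unitPath (clockShift t (F ω)) = pathShift t (Gp ω) := by
      rw [← h4.shiftFun_unitPath, h3]
      rfl
    rw [h2, h2, hΦ _ _ h4.shift h5 hu, h4.invClock_add]
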